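/- The supremum, over all convex hexagons P in the plane, of the infimum over all convex pentagons Q containing P of the ratio |Q|/|P|, equals 7/6. (In the paper's notation, r(5,6) = 7/6.) -/

import Mathlib

open MeasureTheory

/-- A convex `n`-gon in the plane: the convex hull of a finite set of at most `n` points,
having nonempty interior. -/
def IsConvexPolygon (n : ℕ) (Q : Set (ℝ × ℝ)) : Prop :=
  ∃ S : Finset (ℝ × ℝ), S.card ≤ n ∧ Q = convexHull ℝ (S : Set (ℝ × ℝ)) ∧
    (interior Q).Nonempty

theorem cubic_nonneg_aux (a b c d e f : ℝ) (ha : 0 ≤ a) :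
    0 ≤ 984 * a * (a + f - b - e) ^ 2 +
      4050 * a * (e - f) ^ 2 +
      1044 * a * (d - f) ^ 2 +
      1269 * a * (c + e - d - f) ^ 2 +
      750 * a * (a + f - c - d) ^ 2 +
      1695 * a * (c + f - d - e) ^ 2 := by
  positivity

theorem quartic_nonneg_aux (a b c d e f : ℝ) (ha : 0 ≤ a) (hb : 0 ≤ b) (hc : 0 ≤ c) (hd : 0 ≤ d) :
    0 ≤ 4647/2 * a * c * (b + e - d - f) ^ 2 +
      1281 * a * a * (e - f) ^ 2 +
      2877/2 * a * c * (c + e - d - f) ^ 2 +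
      72 * a * c * (a - c) ^ 2 +
      1545/2 * a * b * (a + b - c - f) ^ 2 +
      1131 * a * c * (e - f) ^ 2 +
      4563/2 * a * d * (b + f - c - e) ^ 2 +
      195 * a * b * (b + e - c - f) ^ 2 +
      321 * a * a * (b + e - c - f) ^ 2 +
      51/2 * a * c * (a + d - c - f) ^ 2 +
      189/2 * a * c * (b - c) ^ 2 +
      2961/4 * a * d * (b + e - c - f) ^ 2 := by
  positivity

theorem quadratic_coeff_nonneg (a b c d e f : ℝ) (ha : 0 ≤ a) (hb : 0 ≤ b) (hc : 0 ≤ c) (hd : 0 ≤ d) (he : 0 ≤ e) (hf : 0 ≤ f) :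
    36 * (25 * ((a * (b + f) - f * b) +
      (b * (c + a) - a * c) +
      (c * (d + b) - b * d) +
      (d * (e + c) - c * e) +
      (e * (f + d) - d * f) +
      (f * (a + e) - e * a)) + 10 * ((2 * (b + f) + 5 * (c + e) + 3 * d) * a +
      (2 * (c + a) + 5 * (d + f) + 3 * e) * b +
      (2 * (d + b) + 5 * (e + a) + 3 * f) * c +
      (2 * (e + c) + 5 * (f + b) + 3 * a) * d +
      (2 * (f + d) + 5 * (a + c) + 3 * b) * e +
      (2 * (a + e) + 5 * (b + d) + 3 * c) * f)) ≤
      900 * (a * b + b * c + c * d + d * e + e * f + f * a) + 1020 * (a + b + c + d + e + f) ^ 2 + 289 * (a + b + c + d + e + f) ^ 2 := by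
  have hac := mul_nonneg ha hc
  have hae := mul_nonneg ha he
  have hce := mul_nonneg hc he
  have hbd := mul_nonneg hb hd
  have hbf := mul_nonneg hb hf
  have hdf := mul_nonneg hd hf
  have h1 := mul_nonneg ha hb
  have h2 := mul_nonneg hb hc
  have h3 := mul_nonneg hc hd
  have h4 := mul_nonneg hd he
  have h5 := mul_nonneg he hf
  have h6 := mul_nonneg hf ha
  have h7 := mul_nonneg ha hd
  have h8 := mul_nonneg hb he
  have h9 := mul_nonneg hc hf
  nlinarith [sq_nonneg (a - c), sq_nonneg (b - d), sq_nonneg (c - e), sq_nonneg (d - f),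
    sq_nonneg (e - a), sq_nonneg (f - b), sq_nonneg a, sq_nonneg b, sq_nonneg c, sq_nonneg d,
    sq_nonneg e, sq_nonneg f]

theorem linear_coeff_nonneg (a b c d e f : ℝ) (ha : 0 ≤ a) (hb : 0 ≤ b) (hc : 0 ≤ c) (hd : 0 ≤ d) (he : 0 ≤ e) (hf : 0 ≤ f) :
    36 * ((2 * (b + f) + 5 * (c + e) + 3 * d) ^ 2 * a +
      (2 * (c + a) + 5 * (d + f) + 3 * e) ^ 2 * b +
      (2 * (d + b) + 5 * (e + a) + 3 * f) ^ 2 * c +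
      (2 * (e + c) + 5 * (f + b) + 3 * a) ^ 2 * d +
      (2 * (f + d) + 5 * (a + c) + 3 * b) ^ 2 * e +
      (2 * (a + e) + 5 * (b + d) + 3 * c) ^ 2 * f +
      10 * ((2 * (b + f) + 5 * (c + e) + 3 * d) * (a * (b + f) - f * b) +
      (2 * (c + a) + 5 * (d + f) + 3 * e) * (b * (c + a) - a * c) +
      (2 * (d + b) + 5 * (e + a) + 3 * f) * (c * (d + b) - b * d) +
      (2 * (e + c) + 5 * (f + b) + 3 * a) * (d * (e + c) - c * e) +
      (2 * (f + d) + 5 * (a + c) + 3 * b) * (e * (f + d) - d * f) +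
      (2 * (a + e) + 5 * (b + d) + 3 * c) * (f * (a + e) - e * a))) ≤
      289 * (a + b + c + d + e + f) ^ 3 + 1020 * (a + b + c + d + e + f) * (a * b + b * c + c * d + d * e + e * f + f * a) := by
  linarith [cubic_nonneg_aux a b c d e f ha,
    cubic_nonneg_aux b c d e f a hb,
    cubic_nonneg_aux c d e f a b hc,
    cubic_nonneg_aux d e f a b c hd,
    cubic_nonneg_aux e f a b c d he,
    cubic_nonneg_aux f a b c d e hf,
    cubic_nonneg_aux a f e d c b ha,
    cubic_nonneg_aux b a f e d c hb,
    cubic_nonneg_aux c b a f e d hc,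
    cubic_nonneg_aux d c b a f e hd,
    cubic_nonneg_aux e d c b a f he,
    cubic_nonneg_aux f e d c b a hf]

theorem constant_coeff_nonneg (a b c d e f : ℝ) (ha : 0 ≤ a) (hb : 0 ≤ b) (hc : 0 ≤ c) (hd : 0 ≤ d) (he : 0 ≤ e) (hf : 0 ≤ f) :
    36 * ((2 * (b + f) + 5 * (c + e) + 3 * d) ^ 2 * (a * (b + f) - f * b) +
      (2 * (c + a) + 5 * (d + f) + 3 * e) ^ 2 * (b * (c + a) - a * c) +
      (2 * (d + b) + 5 * (e + a) + 3 * f) ^ 2 * (c * (d + b) - b * d) +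
      (2 * (e + c) + 5 * (f + b) + 3 * a) ^ 2 * (d * (e + c) - c * e) +
      (2 * (f + d) + 5 * (a + c) + 3 * b) ^ 2 * (e * (f + d) - d * f) +
      (2 * (a + e) + 5 * (b + d) + 3 * c) ^ 2 * (f * (a + e) - e * a)) ≤
      289 * (a + b + c + d + e + f) ^ 2 * (a * b + b * c + c * d + d * e + e * f + f * a) := by
  linarith [quartic_nonneg_aux a b c d e f ha hb hc hd,
    quartic_nonneg_aux b c d e f a hb hc hd he,
    quartic_nonneg_aux c d e f a b hc hd he hf,
    quartic_nonneg_aux d e f a b c hd he hf ha,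
    quartic_nonneg_aux e f a b c d he hf ha hb,
    quartic_nonneg_aux f a b c d e hf ha hb hc,
    quartic_nonneg_aux a f e d c b ha hf he hd,
    quartic_nonneg_aux b a f e d c hb ha hf he,
    quartic_nonneg_aux c b a f e d hc hb ha hf,
    quartic_nonneg_aux d c b a f e hd hc hb ha,
    quartic_nonneg_aux e d c b a f he hd hc hb,
    quartic_nonneg_aux f e d c b a hf he hd hc]

theorem weighted_ear_inequality (a b c d e f t : ℝ) (ha : 0 ≤ a) (hb : 0 ≤ b) (hc : 0 ≤ c) (hd : 0 ≤ d) (he : 0 ≤ e) (hf : 0 ≤ f) (ht : 0 ≤ t) :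
    36 * ((5 * t + 2 * (b + f) + 5 * (c + e) + 3 * d) ^ 2 * (a * (t + b + f) - f * b) +
      (5 * t + 2 * (c + a) + 5 * (d + f) + 3 * e) ^ 2 * (b * (t + c + a) - a * c) +
      (5 * t + 2 * (d + b) + 5 * (e + a) + 3 * f) ^ 2 * (c * (t + d + b) - b * d) +
      (5 * t + 2 * (e + c) + 5 * (f + b) + 3 * a) ^ 2 * (d * (t + e + c) - c * e) +
      (5 * t + 2 * (f + d) + 5 * (a + c) + 3 * b) ^ 2 * (e * (t + f + d) - d * f) +
      (5 * t + 2 * (a + e) + 5 * (b + d) + 3 * c) ^ 2 * (f * (t + a + e) - e * a)) ≤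
      (30 * t + 17 * (a + b + c + d + e + f)) ^ 2 *
        (t ^ 2 + t * (a + b + c + d + e + f) + (a * b + b * c + c * d + d * e + e * f + f * a)) := by
  have h2 := mul_nonneg (pow_nonneg ht 2)
    (sub_nonneg.2 (quadratic_coeff_nonneg a b c d e f ha hb hc hd he hf))
  have h1 := mul_nonneg ht (sub_nonneg.2 (linear_coeff_nonneg a b c d e f ha hb hc hd he hf))
  have h0 := constant_coeff_nonneg a b c d e f ha hb hc hd he hf
  have h3 : 0 ≤ t ^ 3 * (a + b + c + d + e + f) := by positivity
  have h4 : 0 ≤ t ^ 4 := by positivity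
  linarith

/-- The planar cross product. -/
def cross (u v : ℝ × ℝ) : ℝ := u.1 * v.2 - u.2 * v.1

/-- Twice the signed area of the triangle `p q r`. -/
def orient (p q r : ℝ × ℝ) : ℝ := cross (q - p) (r - p)

/-- The cyclic sequence `A` runs counterclockwise through the vertices of a strictly convex
polygon. -/
def StrictlyConvexCycle {n : ℕ} [NeZero n] (A : Fin n → ℝ × ℝ) : Prop :=
  ∀ i k, k ≠ i → k ≠ i + 1 → 0 < orient (A i) (A (i + 1)) (A k)

/-- Twice the signed area enclosed by a cyclic sequence of points. -/
def shoelace {n : ℕ} [NeZero n] (A : Fin n → ℝ × ℝ) : ℝ := ∑ i, cross (A i) (A (i + 1))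

theorem thirtysix_le_of_weights (n a : Fin 6 → ℝ) (S : ℝ) (ha : ∀ i, 0 < a i)
    (hn : ∀ i, 0 < n i) (h : 36 * ∑ i, n i ^ 2 * a i ≤ (∑ i, n i) ^ 2 * S) (hS : 0 ≤ S) :
    36 ≤ S * ∑ i, (a i)⁻¹ := by
  have hW : 0 < ∑ i, n i ^ 2 * a i :=
    Finset.sum_pos (fun i _ => mul_pos (pow_pos (hn i) 2) (ha i)) Finset.univ_nonempty
  have hC : (∑ i, n i) ^ 2 ≤ (∑ i, n i ^ 2 * a i) * ∑ i, (a i)⁻¹ := by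
    refine Finset.sum_sq_le_sum_mul_sum_of_sq_le_mul _ (fun i _ => ?_) (fun i _ => ?_)
      (fun i _ => ?_)
    · exact (mul_pos (pow_pos (hn i) 2) (ha i)).le
    · exact (inv_pos.2 (ha i)).le
    · field_simp [(ha i).ne']
      rfl
  refine le_of_mul_le_mul_left ?_ hW
  nlinarith [mul_le_mul_of_nonneg_right hC hS]

theorem hexagon_edges_det (α β γ δ ε φ t : ℝ) (d e : ℝ × ℝ) (k : ℝ) (hk : cross e d = k)
    (A B C D E F : ℝ × ℝ)
    (hAB : B - A = -α • d - β • e) (hBC : C - B = -(t + γ) • d + (β - γ) • e)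
    (hCD : D - C = (γ - δ) • d + γ • e) (hDE : E - D = (t + δ) • d + (t + ε) • e)
    (hEF : F - E = φ • d + (φ - ε) • e) :
    orient F A B = k * (α * (t + β + φ) - φ * β) ∧
    orient A B C = k * (β * (t + γ + α) - α * γ) ∧
    orient B C D = k * (γ * (t + δ + β) - β * δ) ∧
    orient C D E = k * (δ * (t + ε + γ) - γ * ε) ∧
    orient D E F = k * (ε * (t + φ + δ) - δ * φ) ∧
    orient E F A = k * (φ * (t + α + ε) - ε * α) ∧
    cross A B + cross B C + cross C D + cross D E + cross E F + cross F A =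
      k * (t ^ 2 + t * (α + β + γ + δ + ε + φ) +
        (α * β + β * γ + γ * δ + δ * ε + ε * φ + φ * α)) := by
  obtain ⟨A1, A2⟩ := A
  obtain ⟨B1, B2⟩ := B
  obtain ⟨C1, C2⟩ := C
  obtain ⟨D1, D2⟩ := D
  obtain ⟨E1, E2⟩ := E
  obtain ⟨F1, F2⟩ := F
  obtain ⟨d1, d2⟩ := d
  obtain ⟨e1, e2⟩ := e
  simp only [Prod.mk_sub_mk, Prod.smul_mk, Prod.mk_add_mk, smul_eq_mul, Prod.mk.injEq, cross,
    orient] at *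
  obtain ⟨h1, h2⟩ := hAB
  obtain ⟨h3, h4⟩ := hBC
  obtain ⟨h5, h6⟩ := hCD
  obtain ⟨h7, h8⟩ := hDE
  obtain ⟨h9, h10⟩ := hEF
  obtain rfl : B1 = A1 + (-α * d1 - β * e1) := by linarith
  obtain rfl : B2 = A2 + (-α * d2 - β * e2) := by linarith
  obtain rfl := eq_add_of_sub_eq h3
  obtain rfl := eq_add_of_sub_eq h4
  obtain rfl := eq_add_of_sub_eq h5
  obtain rfl := eq_add_of_sub_eq h6
  obtain rfl := eq_add_of_sub_eq h7
  obtain rfl := eq_add_of_sub_eq h8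
  obtain rfl := eq_add_of_sub_eq h9
  obtain rfl := eq_add_of_sub_eq h10
  subst hk
  refine ⟨?_, ?_, ?_, ?_, ?_, ?_, ?_⟩ <;> ring

theorem hexagon_diagonal_coordinates (A B C D E F : ℝ × ℝ)
    (hl : 0 < cross (C - F) (E - B)) (hm : 0 < cross (A - D) (C - F))
    (hn : 0 < cross (E - B) (A - D)) {l m n t : ℝ}
    (hl' : l = cross (C - F) (E - B)) (hm' : m = cross (A - D) (C - F))
    (hn' : n = cross (E - B) (A - D))
    (ht : t = m * n - m * orient B E A - n * orient F C D) :
    let d := (m * n)⁻¹ • (A - D)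
    let e := (n * l)⁻¹ • (E - B)
    let α := m * orient B E A
    let β := l * orient D A B
    let γ := l * orient D A C
    let δ := n * orient F C D
    let ε := n * orient F C E
    let φ := m * orient B E F
    cross e d = (l * m * n)⁻¹ ∧ B - A = -α • d - β • e ∧
      C - B = -(t + γ) • d + (β - γ) • e ∧ D - C = (γ - δ) • d + γ • e ∧
      E - D = (t + δ) • d + (t + ε) • e ∧ F - E = φ • d + (φ - ε) • e := by
  have h1 : l ≠ 0 := by rw [hl']; exact hl.ne'
  have h2 : m ≠ 0 := by rw [hm']; exact hm.ne'
  have h3 : n ≠ 0 := by rw [hn']; exact hn.ne'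
  obtain ⟨A1, A2⟩ := A
  obtain ⟨B1, B2⟩ := B
  obtain ⟨C1, C2⟩ := C
  obtain ⟨D1, D2⟩ := D
  obtain ⟨E1, E2⟩ := E
  obtain ⟨F1, F2⟩ := F
  clear hl hm hn
  simp only [Prod.mk_sub_mk, Prod.smul_mk, Prod.mk_add_mk, smul_eq_mul, Prod.mk.injEq, cross,
    orient] at *
  refine ⟨?_, ⟨?_, ?_⟩, ⟨?_, ?_⟩, ⟨?_, ?_⟩, ⟨?_, ?_⟩, ⟨?_, ?_⟩⟩
  · field_simp
    rw [hn']
  all_goals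
    field_simp
    subst ht hl' hm' hn'
    ring

theorem shoelace_six (A : Fin 6 → ℝ × ℝ) :
    shoelace A = cross (A 0) (A 1) + cross (A 1) (A 2) + cross (A 2) (A 3) + cross (A 3) (A 4) +
      cross (A 4) (A 5) + cross (A 5) (A 0) := by
  simp only [shoelace, Fin.sum_univ_six]
  rfl

theorem StrictlyConvexCycle.rotate {n : ℕ} [NeZero n] {A : Fin n → ℝ × ℝ}
    (h : StrictlyConvexCycle A) (j : Fin n) : StrictlyConvexCycle fun i => A (i + j) := by
  intro i k h1 h2
  have := h (i + j) (k + j) (by simpa using h1) (by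
    rw [add_right_comm]; simpa using h2)
  rwa [add_right_comm] at this

theorem shoelace_rotate {n : ℕ} [NeZero n] (A : Fin n → ℝ × ℝ) (j : Fin n) :
    (shoelace fun i => A (i + j)) = shoelace A := by
  simp only [shoelace]
  refine Fintype.sum_equiv (Equiv.addRight j) _ _ fun i => ?_
  simp [add_right_comm]

/-- Twice the area of the triangle cut off by the vertices adjacent to vertex `i`. -/
def ear {n : ℕ} [NeZero n] (A : Fin n → ℝ × ℝ) (i : Fin n) : ℝ :=
  orient (A (i - 1)) (A i) (A (i + 1))

/-- Up to a positive factor, the signed size of the triangle formed by the main diagonals. -/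
def diagonalGap (A : Fin 6 → ℝ × ℝ) : ℝ :=
  cross (A 0 - A 3) (A 2 - A 5) * cross (A 4 - A 1) (A 0 - A 3) -
    cross (A 0 - A 3) (A 2 - A 5) * orient (A 1) (A 4) (A 0) -
    cross (A 4 - A 1) (A 0 - A 3) * orient (A 5) (A 2) (A 3)

theorem diagonalGap_rotate (A : Fin 6 → ℝ × ℝ) :
    diagonalGap (fun i => A (i + 1)) = -diagonalGap A := by
  have e : (5 : Fin 6) + 1 = 0 := rfl
  have e4 : (4 : Fin 6) + 1 = 5 := rfl
  have e3 : (3 : Fin 6) + 1 = 4 := rfl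
  have e2 : (2 : Fin 6) + 1 = 3 := rfl
  have e1 : (1 : Fin 6) + 1 = 2 := rfl
  simp only [diagonalGap, orient, cross, e, e1, e2, e3, e4, zero_add, Prod.fst_sub, Prod.snd_sub]
  ring

theorem StrictlyConvexCycle.ear_pos_six {A : Fin 6 → ℝ × ℝ} (h : StrictlyConvexCycle A)
    (i : Fin 6) : 0 < ear A i := by
  have := h (i - 1) (i + 1) (by revert i; decide) (by revert i; decide)
  simpa [ear] using this

theorem orient_rotate (p q r : ℝ × ℝ) : orient q r p = orient p q r := by
  simp only [orient, cross, Prod.fst_sub, Prod.snd_sub]; ring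

theorem thirtysix_le_of_diagonalGap_nonneg {A : Fin 6 → ℝ × ℝ} (h : StrictlyConvexCycle A)
    (ht : 0 ≤ diagonalGap A) : 36 ≤ shoelace A * ∑ i, (ear A i)⁻¹ := by
  have hm : 0 < cross (A 0 - A 3) (A 2 - A 5) := by
    have h1 : 0 < orient (A 2) (A 3) (A 5) := h 2 5 (by decide) (by decide)
    have h2 : 0 < orient (A 5) (A 0) (A 2) := h 5 2 (by decide) (by decide)
    have : cross (A 0 - A 3) (A 2 - A 5) = orient (A 2) (A 3) (A 5) + orient (A 5) (A 0) (A 2) := by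
      simp only [orient, cross, Prod.fst_sub, Prod.snd_sub]; ring
    linarith
  have hn : 0 < cross (A 4 - A 1) (A 0 - A 3) := by
    have h1 : 0 < orient (A 3) (A 4) (A 0) := h 3 0 (by decide) (by decide)
    have h2 : 0 < orient (A 0) (A 1) (A 3) := h 0 3 (by decide) (by decide)
    have : cross (A 4 - A 1) (A 0 - A 3) = orient (A 3) (A 4) (A 0) + orient (A 0) (A 1) (A 3) := by
      simp only [orient, cross, Prod.fst_sub, Prod.snd_sub]; ring
    linarith
  have hl : 0 < cross (A 2 - A 5) (A 4 - A 1) := by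
    have h1 : 0 < orient (A 1) (A 2) (A 4) := h 1 4 (by decide) (by decide)
    have h2 : 0 < orient (A 4) (A 5) (A 1) := h 4 1 (by decide) (by decide)
    have : cross (A 2 - A 5) (A 4 - A 1) = orient (A 1) (A 2) (A 4) + orient (A 4) (A 5) (A 1) := by
      simp only [orient, cross, Prod.fst_sub, Prod.snd_sub]; ring
    linarith
  obtain ⟨e0, e1, e2, e3, e4, e5⟩ := hexagon_diagonal_coordinates (A 0) (A 1) (A 2) (A 3) (A 4)
    (A 5) hl hm hn rfl rfl rfl rfl
  obtain ⟨r0, r1, r2, r3, r4, r5, rS⟩ := hexagon_edges_det _ _ _ _ _ _ _ _ _ _ e0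
    (A 0) (A 1) (A 2) (A 3) (A 4) (A 5) e1 e2 e3 e4 e5
  have hα := mul_pos hm (show 0 < orient (A 1) (A 4) (A 0) by
    rw [← orient_rotate]; rw [← orient_rotate]; exact h 0 4 (by decide) (by decide))
  have hβ := mul_pos hl (show 0 < orient (A 3) (A 0) (A 1) by
    rw [← orient_rotate]; exact h 0 3 (by decide) (by decide))
  have hγ := mul_pos hl (show 0 < orient (A 3) (A 0) (A 2) by
    rw [← orient_rotate, ← orient_rotate]; exact h 2 0 (by decide) (by decide))
  have hδ := mul_pos hn (show 0 < orient (A 5) (A 2) (A 3) by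
    rw [← orient_rotate]; exact h 2 5 (by decide) (by decide))
  have hε := mul_pos hn (show 0 < orient (A 5) (A 2) (A 4) by
    rw [← orient_rotate, ← orient_rotate]; exact h 4 2 (by decide) (by decide))
  have hφ := mul_pos hm (show 0 < orient (A 1) (A 4) (A 5) by
    rw [← orient_rotate]; exact h 4 1 (by decide) (by decide))
  have hk : 0 < (cross (A 2 - A 5) (A 4 - A 1) * cross (A 0 - A 3) (A 2 - A 5) *
    cross (A 4 - A 1) (A 0 - A 3))⁻¹ := by positivity
  change 0 ≤ _ - _ - _ at ht
  have key := weighted_ear_inequality _ _ _ _ _ _ _ hα.le hβ.le hγ.le hδ.le hε.le hφ.le ht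
  generalize cross (A 0 - A 3) (A 2 - A 5) * cross (A 4 - A 1) (A 0 - A 3) -
    cross (A 0 - A 3) (A 2 - A 5) * orient (A 1) (A 4) (A 0) -
    cross (A 4 - A 1) (A 0 - A 3) * orient (A 5) (A 2) (A 3) = t at *
  generalize cross (A 0 - A 3) (A 2 - A 5) * orient (A 1) (A 4) (A 0) = a at *
  generalize cross (A 2 - A 5) (A 4 - A 1) * orient (A 3) (A 0) (A 1) = b at *
  generalize cross (A 2 - A 5) (A 4 - A 1) * orient (A 3) (A 0) (A 2) = c at *
  generalize cross (A 4 - A 1) (A 0 - A 3) * orient (A 5) (A 2) (A 3) = d at *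
  generalize cross (A 4 - A 1) (A 0 - A 3) * orient (A 5) (A 2) (A 4) = e at *
  generalize cross (A 0 - A 3) (A 2 - A 5) * orient (A 1) (A 4) (A 5) = f at *
  generalize (cross (A 2 - A 5) (A 4 - A 1) * cross (A 0 - A 3) (A 2 - A 5) *
    cross (A 4 - A 1) (A 0 - A 3))⁻¹ = k at *
  have s0 : ear A 0 = k * (a * (t + b + f) - f * b) := r0
  have s1 : ear A 1 = k * (b * (t + c + a) - a * c) := r1
  have s2 : ear A 2 = k * (c * (t + d + b) - b * d) := r2
  have s3 : ear A 3 = k * (d * (t + e + c) - c * e) := r3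
  have s4 : ear A 4 = k * (e * (t + f + d) - d * f) := r4
  have s5 : ear A 5 = k * (f * (t + a + e) - e * a) := r5
  refine thirtysix_le_of_weights
    ![5 * t + 2 * (b + f) + 5 * (c + e) + 3 * d, 5 * t + 2 * (c + a) + 5 * (d + f) + 3 * e,
      5 * t + 2 * (d + b) + 5 * (e + a) + 3 * f, 5 * t + 2 * (e + c) + 5 * (f + b) + 3 * a,
      5 * t + 2 * (f + d) + 5 * (a + c) + 3 * b, 5 * t + 2 * (a + e) + 5 * (b + d) + 3 * c]
    _ _ h.ear_pos_six ?_ ?_ ?_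
  · intro i
    fin_cases i <;> simp <;> positivity
  · rw [shoelace_six, rS, Fin.sum_univ_six, Fin.sum_univ_six, s0, s1, s2, s3, s4, s5]
    simp [-mul_eq_mul_left_iff]
    have := mul_le_mul_of_nonneg_left key hk.le
    refine le_trans (le_of_eq ?_) (this.trans (le_of_eq ?_))
    · ring
    · ring
  · rw [shoelace_six, rS]
    positivity

theorem StrictlyConvexCycle.thirtysix_le {A : Fin 6 → ℝ × ℝ} (h : StrictlyConvexCycle A) :
    36 ≤ shoelace A * ∑ i, (ear A i)⁻¹ := by
  rcases le_total 0 (diagonalGap A) with ht | ht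
  · exact thirtysix_le_of_diagonalGap_nonneg h ht
  · have := thirtysix_le_of_diagonalGap_nonneg (h.rotate 1) (by
      rw [diagonalGap_rotate]; linarith)
    rw [shoelace_rotate] at this
    convert this using 2
    refine (Fintype.sum_equiv (Equiv.addRight 1) _ _ fun i => ?_).symm
    simp [ear]

/-- The edge vector from vertex `i` to vertex `i + 1`. -/
def edge {n : ℕ} [NeZero n] (A : Fin n → ℝ × ℝ) (i : Fin n) : ℝ × ℝ := A (i + 1) - A i

/-- The cross product of the two edges adjacent to edge `i`. -/
def turn {n : ℕ} [NeZero n] (A : Fin n → ℝ × ℝ) (i : Fin n) : ℝ :=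
  cross (edge A (i - 1)) (edge A (i + 1))

/-- The quadratic form measuring the area enclosed by parallel translates of the sides, where
`v i` is proportional to the displacement of side `i`. -/
noncomputable def areaForm {n : ℕ} [NeZero n] (A : Fin n → ℝ × ℝ) (v : Fin n → ℝ) : ℝ :=
  ∑ i, (2 * (v (i - 1) * v i / ear A i) - v i ^ 2 * (turn A i / (ear A i * ear A (i + 1))))

/-- The side displacements caused by the homothety with ratio `g` and centre `O` followed by the
translation by `-w`. -/
def homothetyShift {n : ℕ} [NeZero n] (A : Fin n → ℝ × ℝ) (g : ℝ) (O w : ℝ × ℝ) (i : Fin n) : ℝ :=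
  cross (g • (A i - O) - w) (edge A i)

theorem homothetyShift_relation {n : ℕ} [NeZero n] (A : Fin n → ℝ × ℝ) (g : ℝ) (O w : ℝ × ℝ)
    (i : Fin n) :
    homothetyShift A g O w (i - 1) * ear A (i + 1) + homothetyShift A g O w (i + 1) * ear A i -
      homothetyShift A g O w i * turn A i = g * (ear A i * ear A (i + 1)) := by
  simp only [homothetyShift, turn, ear, edge, orient, cross, Prod.fst_sub, Prod.snd_sub,
    Prod.smul_fst, Prod.smul_snd, smul_eq_mul, sub_add_cancel, add_sub_cancel_right]
  ring

theorem sum_homothetyShift {n : ℕ} [NeZero n] (A : Fin n → ℝ × ℝ) (g : ℝ) (O w : ℝ × ℝ) :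
    ∑ i, homothetyShift A g O w i = g * shoelace A := by
  have h : ∀ c : ℝ × ℝ, ∑ i, cross c (A (i + 1)) = ∑ i, cross c (A i) := fun c =>
    Fintype.sum_equiv (Equiv.addRight 1) _ _ fun i => rfl
  have h' : ∀ i, homothetyShift A g O w i = g * cross (A i) (A (i + 1)) -
      (cross (g • O + w) (A (i + 1)) - cross (g • O + w) (A i)) := by
    intro i
    simp only [homothetyShift, edge, cross, Prod.fst_sub, Prod.snd_sub, Prod.fst_add, Prod.snd_add,
      Prod.smul_fst, Prod.smul_snd, smul_eq_mul]
    ring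
  simp only [h', Finset.sum_sub_distrib, h, sub_self, sub_zero, shoelace, Finset.mul_sum]

theorem areaForm_one_sub_homothetyShift {n : ℕ} [NeZero n] (A : Fin n → ℝ × ℝ)
    (ha : ∀ i, ear A i ≠ 0) (g : ℝ) (O w : ℝ × ℝ) :
    areaForm A (fun i => 1 - homothetyShift A g O w i) =
      areaForm A (fun _ => 1) - 2 * n * g + g ^ 2 * shoelace A := by
  set u := homothetyShift A g O w
  have hr : ∀ i, u (i - 1) / ear A i + u (i + 1) / ear A (i + 1) -
      u i * (turn A i / (ear A i * ear A (i + 1))) = g := by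
    intro i
    have := homothetyShift_relation A g O w i
    have h1 := ha i
    have h2 := ha (i + 1)
    field_simp
    linarith
  have hs : ∀ f : Fin n → ℝ, ∑ i, f (i + 1) = ∑ i, f i := fun f =>
    Fintype.sum_equiv (Equiv.addRight 1) _ _ fun i => rfl
  have e1 := hs fun i => u i / ear A i
  have e3 := hs fun i => u (i - 1) * u i / ear A i
  simp only [add_sub_cancel_right] at e1 e3
  have key : ∀ i, (2 * ((1 - u (i - 1)) * (1 - u i) / ear A i) -
      (1 - u i) ^ 2 * (turn A i / (ear A i * ear A (i + 1)))) =
      (2 * (1 * 1 / ear A i) - 1 ^ 2 * (turn A i / (ear A i * ear A (i + 1)))) - 2 * g + g * u i +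
      (2 * (u (i + 1) / ear A (i + 1)) - 2 * (u i / ear A i)) +
      (u (i - 1) * u i / ear A i - u i * u (i + 1) / ear A (i + 1)) := by
    intro i
    linear_combination (u i - 2) * hr i
  simp only [areaForm, key, Finset.sum_add_distrib, Finset.sum_sub_distrib, ← Finset.mul_sum, e1,
    e3, Finset.sum_const, Finset.card_univ, Fintype.card_fin, nsmul_eq_mul]
  rw [sum_homothetyShift A g O w]
  ring

theorem turn_div_eq {n : ℕ} [NeZero n] (A : Fin n → ℝ × ℝ) (ha : ∀ i, ear A i ≠ 0) (c : ℝ × ℝ)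
    (i : Fin n) (hi : cross c (edge A i) ≠ 0) :
    turn A i / (ear A i * ear A (i + 1)) =
      cross c (edge A (i - 1)) / cross c (edge A i) / ear A i +
      cross c (edge A (i + 1)) / cross c (edge A i) / ear A (i + 1) := by
  have := homothetyShift_relation A 0 0 (-c) i
  simp only [homothetyShift, zero_smul, sub_neg_eq_add, zero_add, zero_mul] at this
  have h1 := ha i
  have h2 := ha (i + 1)
  field_simp
  linarith

theorem StrictlyConvexCycle.cross_edge_pos {A : Fin 6 → ℝ × ℝ} (h : StrictlyConvexCycle A)
    {i : Fin 6} (h0 : i ≠ 0) (h5 : i ≠ 5) (hi : 0 ≤ cross (edge A 0) (edge A (i + 1))) :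
    0 < cross (edge A 0) (edge A i) := by
  have p1 : 0 < orient (A 0) (A 1) (A (i + 1)) :=
    h 0 _ (by revert h5; clear hi; revert i; decide) (by simpa using h0)
  have p2 : 0 < orient (A (i + 1)) (A (i + 1 + 1)) (A 1) :=
    h _ _ (by simpa using h0) (by revert h5; clear hi h0 p1; revert i; decide)
  have p3 : 0 < ear A (i + 1) := h.ear_pos_six _
  have p4 : 0 ≤ orient (A i) (A (i + 1)) (A 1) := by
    by_cases h1 : i = 1
    · simp [h1, orient, cross]
    · exact (h i 1 (Ne.symm h1) (by simpa using h0)).le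
  have key : cross (edge A 0) (edge A i) * orient (A (i + 1)) (A (i + 1 + 1)) (A 1) =
      cross (edge A 0) (edge A (i + 1)) * orient (A i) (A (i + 1)) (A 1) +
        orient (A 0) (A 1) (A (i + 1)) * ear A (i + 1) := by
    simp only [ear, edge, orient, cross, Prod.fst_sub, Prod.snd_sub, add_sub_cancel_right,
      zero_add]
    ring
  exact pos_of_mul_pos_left (key ▸ by positivity) p2.le

theorem two_mul_le_div_add_div {v v' z z' a : ℝ} (ha : 0 < a) (h : 0 < z / z') :
    2 * (v * v' / a) ≤ v' ^ 2 * (z / z' / a) + v ^ 2 * (z' / z / a) := by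
  have hz : z ≠ 0 := by rintro rfl; simp at h
  have hz' : z' ≠ 0 := by rintro rfl; simp at h
  have : v' ^ 2 * (z / z' / a) + v ^ 2 * (z' / z / a) - 2 * (v * v' / a) =
      z / z' / a * (v' - v * (z' / z)) ^ 2 := by
    field_simp
    ring
  have : 0 ≤ z / z' / a * (v' - v * (z' / z)) ^ 2 := by positivity
  linarith

theorem areaForm_six_nonpos {A : Fin 6 → ℝ × ℝ} (h : StrictlyConvexCycle A) {v : Fin 6 → ℝ}
    {k : Fin 6} (hk0 : k ≠ 0) (hk5 : k ≠ 5) (hk : 0 < cross (edge A 0) (edge A k))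
    (hk' : cross (edge A 0) (edge A (k + 1)) ≤ 0) (v0 : v 0 = 0) (vk : v k = 0)
    (vk' : v (k + 1) = 0) : areaForm A v ≤ 0 := by
  have ha := h.ear_pos_six
  have ht := turn_div_eq A (fun i => (ha i).ne') (edge A 0)
  have s1 : (0 : Fin 6) - 1 = 5 := rfl
  have s2 : (1 : Fin 6) - 1 = 0 := rfl
  have s3 : (2 : Fin 6) - 1 = 1 := rfl
  have s4 : (3 : Fin 6) - 1 = 2 := rfl
  have s5 : (4 : Fin 6) - 1 = 3 := rfl
  have s6 : (5 : Fin 6) - 1 = 4 := rfl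
  have t1 : (0 : Fin 6) + 1 = 1 := rfl
  have t2 : (1 : Fin 6) + 1 = 2 := rfl
  have t3 : (2 : Fin 6) + 1 = 3 := rfl
  have t4 : (3 : Fin 6) + 1 = 4 := rfl
  have t5 : (4 : Fin 6) + 1 = 5 := rfl
  have t6 : (5 : Fin 6) + 1 = 0 := rfl
  have y0 : cross (edge A 0) (edge A 0) = 0 := by simp [cross, mul_comm]
  simp only [areaForm, Fin.sum_univ_six, s1, s2, s3, s4, s5, s6]
  have c2 : 0 ≤ cross (edge A 0) (edge A 2) → 0 < cross (edge A 0) (edge A 1) :=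
    fun hh => h.cross_edge_pos (by decide) (by decide) hh
  have c3 : 0 ≤ cross (edge A 0) (edge A 3) → 0 < cross (edge A 0) (edge A 2) :=
    fun hh => h.cross_edge_pos (by decide) (by decide) hh
  have c4 : 0 ≤ cross (edge A 0) (edge A 4) → 0 < cross (edge A 0) (edge A 3) :=
    fun hh => h.cross_edge_pos (by decide) (by decide) hh
  have c5 : 0 ≤ cross (edge A 0) (edge A 5) → 0 < cross (edge A 0) (edge A 4) :=
    fun hh => h.cross_edge_pos (by decide) (by decide) hh
  have d1 := ht 1
  have d2 := ht 2
  have d3 := ht 3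
  have d4 := ht 4
  have d5 := ht 5
  simp only [s2, s3, s4, s5, s6, t1, t2, t3, t4, t5, t6, y0, zero_div, zero_add, add_zero]
    at d1 d2 d3 d4 d5 ⊢
  fin_cases k
  · exact absurd rfl hk0
  · replace hk : 0 < cross (edge A 0) (edge A 1) := hk
    replace hk' : cross (edge A 0) (edge A 2) ≤ 0 := hk'
    replace vk : v 1 = 0 := vk
    replace vk' : v 2 = 0 := vk'
    have p3 : cross (edge A 0) (edge A 3) < 0 := by
      by_contra! hh
      exact absurd (c3 hh) (by linarith)
    have p4 : cross (edge A 0) (edge A 4) < 0 := by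
      by_contra! hh
      exact absurd (c4 hh) (by linarith)
    have p5 : cross (edge A 0) (edge A 5) < 0 := by
      by_contra! hh
      exact absurd (c5 hh) (by linarith)
    rw [v0, vk, vk', d3 p3.ne, d4 p4.ne, d5 p5.ne]
    simp only [zero_mul, mul_zero, zero_div, add_zero, zero_add, ne_eq, OfNat.ofNat_ne_zero,
      not_false_eq_true, zero_pow, sub_self]
    linarith [two_mul_le_div_add_div (v := v 3) (v' := v 4) (ha 4) (div_pos_of_neg_of_neg p3 p4),
      two_mul_le_div_add_div (v := v 4) (v' := v 5) (ha 5) (div_pos_of_neg_of_neg p4 p5),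
      mul_nonneg (sq_nonneg (v 3)) (div_nonneg (div_nonneg_of_nonpos hk' p3.le) (ha 3).le)]
  · replace hk : 0 < cross (edge A 0) (edge A 2) := hk
    replace hk' : cross (edge A 0) (edge A 3) ≤ 0 := hk'
    replace vk : v 2 = 0 := vk
    replace vk' : v 3 = 0 := vk'
    have p1 : 0 < cross (edge A 0) (edge A 1) := c2 hk.le
    have p4 : cross (edge A 0) (edge A 4) < 0 := by
      by_contra! hh
      exact absurd (c4 hh) (by linarith)
    have p5 : cross (edge A 0) (edge A 5) < 0 := by
      by_contra! hh
      exact absurd (c5 hh) (by linarith)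
    rw [v0, vk, vk', d1 p1.ne', d4 p4.ne, d5 p5.ne]
    simp only [zero_mul, mul_zero, zero_div, add_zero, zero_add, ne_eq, OfNat.ofNat_ne_zero,
      not_false_eq_true, zero_pow, sub_self]
    linarith [two_mul_le_div_add_div (v := v 4) (v' := v 5) (ha 5) (div_pos_of_neg_of_neg p4 p5),
      mul_nonneg (sq_nonneg (v 1)) (div_nonneg (div_nonneg hk.le p1.le) (ha 2).le),
      mul_nonneg (sq_nonneg (v 4)) (div_nonneg (div_nonneg_of_nonpos hk' p4.le) (ha 4).le)]
  · replace hk : 0 < cross (edge A 0) (edge A 3) := hk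
    replace hk' : cross (edge A 0) (edge A 4) ≤ 0 := hk'
    replace vk : v 3 = 0 := vk
    replace vk' : v 4 = 0 := vk'
    have p2 : 0 < cross (edge A 0) (edge A 2) := c3 hk.le
    have p1 : 0 < cross (edge A 0) (edge A 1) := c2 p2.le
    have p5 : cross (edge A 0) (edge A 5) < 0 := by
      by_contra! hh
      exact absurd (c5 hh) (by linarith)
    rw [v0, vk, vk', d1 p1.ne', d2 p2.ne', d5 p5.ne]
    simp only [zero_mul, mul_zero, zero_div, add_zero, zero_add, ne_eq, OfNat.ofNat_ne_zero,
      not_false_eq_true, zero_pow, sub_self]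
    linarith [two_mul_le_div_add_div (v := v 1) (v' := v 2) (ha 2) (div_pos p1 p2),
      mul_nonneg (sq_nonneg (v 2)) (div_nonneg (div_nonneg hk.le p2.le) (ha 3).le),
      mul_nonneg (sq_nonneg (v 5)) (div_nonneg (div_nonneg_of_nonpos hk' p5.le) (ha 5).le)]
  · replace hk : 0 < cross (edge A 0) (edge A 4) := hk
    replace hk' : cross (edge A 0) (edge A 5) ≤ 0 := hk'
    replace vk : v 4 = 0 := vk
    replace vk' : v 5 = 0 := vk'
    have p3 : 0 < cross (edge A 0) (edge A 3) := c4 hk.le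
    have p2 : 0 < cross (edge A 0) (edge A 2) := c3 p3.le
    have p1 : 0 < cross (edge A 0) (edge A 1) := c2 p2.le
    rw [v0, vk, vk', d1 p1.ne', d2 p2.ne', d3 p3.ne']
    simp only [zero_mul, mul_zero, zero_div, add_zero, zero_add, ne_eq, OfNat.ofNat_ne_zero,
      not_false_eq_true, zero_pow, sub_self]
    linarith [two_mul_le_div_add_div (v := v 1) (v' := v 2) (ha 2) (div_pos p1 p2),
      two_mul_le_div_add_div (v := v 2) (v' := v 3) (ha 3) (div_pos p2 p3),
      mul_nonneg (sq_nonneg (v 3)) (div_nonneg (div_nonneg hk.le p3.le) (ha 4).le)]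
  · exact absurd rfl hk5

theorem areaForm_one_le {A : Fin 6 → ℝ × ℝ} (h : StrictlyConvexCycle A)
    (hS : 0 < shoelace A) : areaForm A (fun _ => 1) ≤ 36 / shoelace A := by
  have ha := h.ear_pos_six
  obtain ⟨k, hk0, hk5, hk, hk'⟩ : ∃ k : Fin 6, k ≠ 0 ∧ k ≠ 5 ∧ 0 < cross (edge A 0) (edge A k) ∧
      cross (edge A 0) (edge A (k + 1)) ≤ 0 := by
    by_contra! hc
    have h1 : 0 < cross (edge A 0) (edge A 1) := by
      have : cross (edge A 0) (edge A 1) = ear A 1 := by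
        have e : (1 : Fin 6) + 1 = 2 := rfl
        simp only [ear, edge, orient, cross, Prod.fst_sub, Prod.snd_sub, e, sub_self, zero_add]
        ring
      exact this ▸ ha 1
    have h2 := hc 1 (by decide) (by decide) h1
    have h3 := hc 2 (by decide) (by decide) h2
    have h4 := hc 3 (by decide) (by decide) h3
    have h5 : 0 < cross (edge A 0) (edge A 5) := hc 4 (by decide) (by decide) h4
    have h0 : 0 < orient (A 5) (A 0) (A 1) := h 5 1 (by decide) (by decide)
    have : cross (edge A 0) (edge A 5) = - orient (A 5) (A 0) (A 1) := by
      have e : (5 : Fin 6) + 1 = 0 := rfl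
      simp only [edge, orient, cross, Prod.fst_sub, Prod.snd_sub, e, zero_add]
      ring
    linarith
  have hH : 0 < orient (A 0) (A 1) (A (k + 1)) :=
    h 0 _ (by clear hk hk'; revert hk5; clear hk0; revert k; decide) (by simpa using hk0)
  have hak := ha (k + 1)
  set g := (1 + (cross (edge A 0) (edge A k) - cross (edge A 0) (edge A (k + 1))) / ear A (k + 1)) /
    orient (A 0) (A 1) (A (k + 1)) with hg
  set w := (ear A (k + 1))⁻¹ • (edge A (k + 1) - edge A k) with hw
  have he : ear A (k + 1) = cross (edge A k) (edge A (k + 1)) := by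
    simp only [ear, edge, orient, cross, Prod.fst_sub, Prod.snd_sub, add_sub_cancel_right]
    ring
  have u0 : homothetyShift A g (A (k + 1)) w 0 = 1 := by
    have : homothetyShift A g (A (k + 1)) w 0 = g * orient (A 0) (A 1) (A (k + 1)) -
        (cross (edge A 0) (edge A k) - cross (edge A 0) (edge A (k + 1))) / ear A (k + 1) := by
      simp only [homothetyShift, hw, edge, orient, cross, Prod.fst_sub, Prod.snd_sub,
        Prod.smul_fst, Prod.smul_snd, smul_eq_mul, zero_add]
      ring
    rw [this, hg, div_mul_cancel₀ _ hH.ne']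
    ring
  have uk : homothetyShift A g (A (k + 1)) w k = 1 := by
    have : homothetyShift A g (A (k + 1)) w k = cross (edge A k) (edge A (k + 1)) / ear A (k + 1) := by
      simp only [homothetyShift, hw, edge, cross, Prod.fst_sub, Prod.snd_sub,
        Prod.smul_fst, Prod.smul_snd, smul_eq_mul]
      ring
    rw [this, ← he, div_self hak.ne']
  have uk' : homothetyShift A g (A (k + 1)) w (k + 1) = 1 := by
    have : homothetyShift A g (A (k + 1)) w (k + 1) =
        cross (edge A k) (edge A (k + 1)) / ear A (k + 1) := by
      simp only [homothetyShift, hw, edge, cross, Prod.fst_sub, Prod.snd_sub,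
        Prod.smul_fst, Prod.smul_snd, smul_eq_mul]
      ring
    rw [this, ← he, div_self hak.ne']
  have key := areaForm_six_nonpos h (v := fun i => 1 - homothetyShift A g (A (k + 1)) w i) hk0 hk5
    hk hk' (by simp [u0]) (by simp [uk]) (by simp [uk'])
  rw [areaForm_one_sub_homothetyShift A (fun i => (ha i).ne')] at key
  rw [le_div_iff₀ hS]
  push_cast at key
  nlinarith [sq_nonneg (g * shoelace A - 6), mul_nonneg hS.le (sub_nonneg.2 key)]

theorem StrictlyConvexCycle.exists_removable_side {A : Fin 6 → ℝ × ℝ} (h : StrictlyConvexCycle A)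
    (hS : 0 < shoelace A) :
    ∃ i, 0 < turn A i ∧ 6 * (ear A i * ear A (i + 1)) ≤ shoelace A * turn A i := by
  have ha := h.ear_pos_six
  have h1 := areaForm_one_le h hS
  have h2 := h.thirtysix_le
  have h3 : ∑ _i : Fin 6, 6 / shoelace A ≤ ∑ i, turn A i / (ear A i * ear A (i + 1)) := by
    simp only [areaForm, Finset.sum_sub_distrib, one_pow, one_mul, ← Finset.mul_sum, one_div] at h1
    have h4 : 36 / shoelace A ≤ ∑ i, (ear A i)⁻¹ := by
      rw [div_le_iff₀ hS]; linarith
    have h5 : ∑ _i : Fin 6, 6 / shoelace A = 36 / shoelace A := by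
      simp; ring
    linarith
  obtain ⟨i, -, hi⟩ := Finset.exists_le_of_sum_le Finset.univ_nonempty h3
  have hp := mul_pos (ha i) (ha (i + 1))
  rw [div_le_div_iff₀ hS hp] at hi
  refine ⟨i, ?_, by linarith⟩
  exact pos_of_mul_pos_left (lt_of_lt_of_le (by positivity) hi) hS.le

/-- The points of `T` are in convex position. -/
def ConvexPosition (T : Finset (ℝ × ℝ)) : Prop :=
  ∀ p ∈ T, p ∉ convexHull ℝ ((T.erase p : Finset (ℝ × ℝ)) : Set (ℝ × ℝ))

theorem exists_convexPosition_subset (S : Finset (ℝ × ℝ)) :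
    ∃ T ⊆ S, convexHull ℝ (T : Set (ℝ × ℝ)) = convexHull ℝ (S : Set (ℝ × ℝ)) ∧
      ConvexPosition T := by
  classical
  have hne : (S.powerset.filter fun T : Finset (ℝ × ℝ) =>
      convexHull ℝ (T : Set (ℝ × ℝ)) = convexHull ℝ (S : Set (ℝ × ℝ))).Nonempty :=
    ⟨S, by simp⟩
  obtain ⟨T, hT, hmin⟩ := Finset.exists_min_image _ Finset.card hne
  simp only [Finset.mem_filter, Finset.mem_powerset] at hT hmin
  refine ⟨T, hT.1, hT.2, fun p hp hmem => ?_⟩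
  have hsub : convexHull ℝ (T : Set (ℝ × ℝ)) ⊆
      convexHull ℝ ((T.erase p : Finset (ℝ × ℝ)) : Set (ℝ × ℝ)) := by
    refine convexHull_min (fun x hx => ?_) (convex_convexHull ℝ _)
    by_cases h : x = p
    · exact h ▸ hmem
    · exact subset_convexHull ℝ _ (by simp [h, Finset.mem_coe.1 hx])
  have h1 := hmin (T.erase p) ⟨(T.erase_subset p).trans hT.1, by
    rw [← hT.2]
    exact Set.Subset.antisymm (convexHull_mono (by simp)) hsub⟩
  have h2 := Finset.card_erase_lt_of_mem hp
  omega

/-- Every three points of the sequence, taken in order, form a counterclockwise triangle. -/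
def ConvexChain {n : ℕ} (q : Fin n → ℝ × ℝ) : Prop :=
  ∀ i j k, i < j → j < k → 0 < orient (q i) (q j) (q k)

theorem mem_convexHull_triple {p a b c : ℝ × ℝ} {s : Set (ℝ × ℝ)} (ha : a ∈ s) (hb : b ∈ s)
    (hc : c ∈ s) (h : 0 < orient a b c) (h1 : 0 ≤ orient p b c) (h2 : 0 ≤ orient a p c)
    (h3 : 0 ≤ orient a b p) : p ∈ convexHull ℝ s := by
  have hsum : orient p b c + orient a p c + orient a b p = orient a b c := by
    simp only [orient, cross, Prod.fst_sub, Prod.snd_sub]; ring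
  have hp : p = (orient p b c / orient a b c) • a + (orient a p c / orient a b c) • b +
      (orient a b p / orient a b c) • c := by
    have : orient a b c • p = orient p b c • a + orient a p c • b + orient a b p • c := by
      ext <;> simp only [orient, cross, Prod.fst_sub, Prod.snd_sub, Prod.smul_fst, Prod.smul_snd,
        Prod.fst_add, Prod.snd_add, smul_eq_mul] <;> ring
    refine ((eq_inv_smul_iff₀ h.ne').2 this).trans ?_
    simp only [smul_add, smul_smul, div_eq_inv_mul]
  rw [hp]
  have := (convex_convexHull ℝ s).sum_mem (t := Finset.univ)
    (w := ![orient p b c / orient a b c, orient a p c / orient a b c, orient a b p / orient a b c])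
    (z := ![a, b, c]) ?_ ?_ ?_
  · simpa [Fin.sum_univ_three] using this
  · intro i _
    fin_cases i <;> simp <;> positivity
  · simp [Fin.sum_univ_three]
    field_simp
    exact hsum
  · intro i _
    fin_cases i <;> simp <;> exact subset_convexHull ℝ s ‹_›

/-- A strictly increasing function of the angle on the right half plane. -/
noncomputable def pseudoAngle (v : ℝ × ℝ) : ℝ := v.2 / (|v.1| + |v.2|)

theorem cross_pos_of_pseudoAngle_lt {u v : ℝ × ℝ} (hu : 0 < u.1 ∨ u.1 = 0 ∧ 0 < u.2)
    (hv : 0 < v.1 ∨ v.1 = 0 ∧ 0 < v.2) (h : pseudoAngle u < pseudoAngle v) : 0 < cross u v := by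
  obtain ⟨a, b⟩ := u
  obtain ⟨c, d⟩ := v
  simp only [pseudoAngle, cross] at *
  have hu0 : 0 < |a| + |b| := by rcases hu with h | ⟨_, h⟩ <;> positivity
  have hv0 : 0 < |c| + |d| := by rcases hv with h | ⟨_, h⟩ <;> positivity
  have ha : 0 ≤ a := by rcases hu with h | ⟨h, _⟩ <;> linarith
  have hc : 0 ≤ c := by rcases hv with h | ⟨h, _⟩ <;> linarith
  rw [div_lt_div_iff₀ hu0 hv0, abs_of_nonneg ha, abs_of_nonneg hc] at h
  rcases le_total 0 b with hb | hb <;> rcases le_total 0 d with hd | hd <;>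
    simp only [abs_of_nonneg, abs_of_nonpos, hb, hd] at h
  · linarith
  · exfalso
    nlinarith [mul_nonneg hb hc, mul_nonneg ha (neg_nonneg.2 hd), mul_nonneg hb (neg_nonneg.2 hd)]
  · have h1 := mul_nonneg (neg_nonneg.2 hb) hc
    have h2 := mul_nonneg ha hd
    rcases hu with hu | hu
    · rcases hv with hv | hv
      · by_contra! hcon
        have h3 : -b * c = 0 := by linarith
        have h4 : a * d = 0 := by linarith
        have h5 : b = 0 := by
          rcases mul_eq_zero.1 h3 with h | h <;> linarith
        have h6 : d = 0 := by
          rcases mul_eq_zero.1 h4 with h | h <;> linarith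
        simp [h5, h6] at h
      · nlinarith [mul_pos hu hv.2, hv.1]
    · linarith
  · linarith

theorem smul_eq_smul_of_pseudoAngle_eq {u v : ℝ × ℝ} (hu : 0 < u.1 ∨ u.1 = 0 ∧ 0 < u.2)
    (hv : 0 < v.1 ∨ v.1 = 0 ∧ 0 < v.2) (h : pseudoAngle u = pseudoAngle v) :
    (|v.1| + |v.2|) • u = (|u.1| + |u.2|) • v := by
  obtain ⟨a, b⟩ := u
  obtain ⟨c, d⟩ := v
  simp only [pseudoAngle, Prod.smul_mk, smul_eq_mul, Prod.mk.injEq] at *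
  have hu0 : 0 < |a| + |b| := by rcases hu with h | ⟨_, h⟩ <;> positivity
  have hv0 : 0 < |c| + |d| := by rcases hv with h | ⟨_, h⟩ <;> positivity
  have ha : 0 ≤ a := by rcases hu with h | ⟨h, _⟩ <;> linarith
  have hc : 0 ≤ c := by rcases hv with h | ⟨h, _⟩ <;> linarith
  rw [div_eq_div_iff hu0.ne' hv0.ne', abs_of_nonneg ha, abs_of_nonneg hc] at h
  rw [abs_of_nonneg ha, abs_of_nonneg hc]
  refine ⟨?_, by linarith⟩
  rcases le_total 0 b with hb | hb <;> rcases le_total 0 d with hd | hd <;>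
    simp only [abs_of_nonneg, abs_of_nonpos, hb, hd] at h ⊢
  · linarith
  · have h1 := mul_nonneg hb hc
    have h2 := mul_nonneg ha (neg_nonneg.2 hd)
    have h3 := mul_nonneg hb (neg_nonneg.2 hd)
    linarith
  · have h1 := mul_nonneg (neg_nonneg.2 hb) hc
    have h2 := mul_nonneg ha hd
    have h3 := mul_nonneg (neg_nonneg.2 hb) hd
    linarith
  · linarith

theorem mem_convexHull_of_smul_eq {p a b : ℝ × ℝ} {s : Set (ℝ × ℝ)} (ha : a ∈ s) (hb : b ∈ s)
    {r t : ℝ} (hr : 0 ≤ r) (ht : 0 < t) (hrt : r ≤ t) (h : t • (p - a) = r • (b - a)) :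
    p ∈ convexHull ℝ s := by
  have hp : p = (1 - r / t) • a + (r / t) • b := by
    have h1 : p - a = (r / t) • (b - a) := by
      rw [div_eq_inv_mul, mul_smul, ← h, inv_smul_smul₀ ht.ne']
    rw [← sub_add_cancel p a, h1]
    module
  rw [hp]
  exact convex_convexHull ℝ s (subset_convexHull ℝ s ha) (subset_convexHull ℝ s hb)
    (sub_nonneg.2 ((div_le_one ht).2 hrt)) (div_nonneg hr ht.le) (by ring)

theorem exists_convexChain {T : Finset (ℝ × ℝ)} (hT : ConvexPosition T) {m : ℕ}
    (hm : T.card = m + 1) :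
    ∃ q : Fin (m + 1) → ℝ × ℝ, ConvexChain q ∧ Set.range q = T := by
  classical
  have hne : T.Nonempty := Finset.card_pos.1 (by omega)
  obtain ⟨o, ho, hmin⟩ := Finset.exists_min_image T (fun p => toLex p) hne
  have hpos : ∀ p ∈ T.erase o, 0 < (p - o).1 ∨ (p - o).1 = 0 ∧ 0 < (p - o).2 := by
    intro p hp
    obtain ⟨h1, h2⟩ := Finset.mem_erase.1 hp
    have h3 := hmin p h2
    rw [Prod.Lex.toLex_le_toLex] at h3
    rcases h3 with h3 | ⟨h3, h4⟩
    · exact Or.inl (sub_pos.2 h3)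
    · refine Or.inr ⟨sub_eq_zero.2 h3.symm, sub_pos.2 (lt_of_le_of_ne h4 fun h5 => h1 ?_)⟩
      exact Prod.ext h3.symm h5.symm
  have hinj : Set.InjOn (fun p => pseudoAngle (p - o)) (T.erase o : Finset (ℝ × ℝ)) := by
    intro p hp p' hp' heq
    by_contra hne'
    have h1 := smul_eq_smul_of_pseudoAngle_eq (hpos p hp) (hpos p' hp') heq
    have hs : ∀ v : ℝ × ℝ, (0 < v.1 ∨ v.1 = 0 ∧ 0 < v.2) → 0 < |v.1| + |v.2| := by
      rintro v (h | ⟨_, h⟩) <;> positivity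
    have hu := hs _ (hpos p hp)
    have hv := hs _ (hpos p' hp')
    have hp2 := Finset.mem_erase.1 hp
    have hp2' := Finset.mem_erase.1 hp'
    rcases le_total (|(p - o).1| + |(p - o).2|) (|(p' - o).1| + |(p' - o).2|) with h | h
    · refine hT p hp2.2 (mem_convexHull_of_smul_eq (a := o) (b := p') ?_ ?_ hu.le hv h h1)
      · simp [ho, hp2.1.symm]
      · simp [hp2'.2, Ne.symm hne']
    · refine hT p' hp2'.2 (mem_convexHull_of_smul_eq (a := o) (b := p) ?_ ?_ hv.le hu h h1.symm)
      · simp [ho, hp2'.1.symm]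
      · simp [hp2.2, hne']
  have hcard : ((T.erase o).image fun p => pseudoAngle (p - o)).card = m := by
    rw [Finset.card_image_of_injOn hinj, Finset.card_erase_of_mem ho, hm, Nat.add_sub_cancel]
  set e := Finset.orderEmbOfFin _ hcard with he
  have hf : ∀ i, ∃ p ∈ T.erase o, pseudoAngle (p - o) = e i := fun i =>
    Finset.mem_image.1 (Finset.orderEmbOfFin_mem _ hcard i)
  choose f hfT hfe using hf
  have hor : ∀ i j, i < j → 0 < orient o (f i) (f j) := fun i j hij =>
    cross_pos_of_pseudoAngle_lt (hpos _ (hfT i)) (hpos _ (hfT j)) (by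
      rw [hfe, hfe]; exact e.strictMono hij)
  have hfi : Function.Injective f := fun i j hij => e.injective (by rw [← hfe, ← hfe, hij])
  refine ⟨Fin.cons o f, ?_, ?_⟩
  · intro i j k hij hjk
    obtain ⟨j, rfl⟩ := Fin.exists_succ_eq.2 (Fin.ne_zero_of_lt hij)
    obtain ⟨k, rfl⟩ := Fin.exists_succ_eq.2 (Fin.ne_zero_of_lt hjk)
    rw [Fin.succ_lt_succ_iff] at hjk
    simp only [Fin.cons_succ]
    refine Fin.cases (fun _ => ?_) (fun i hij => ?_) i hij
    · exact hor j k hjk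
    · rw [Fin.succ_lt_succ_iff] at hij
      simp only [Fin.cons_succ]
      by_contra! hcon
      have hj := Finset.mem_erase.1 (hfT j)
      refine hT (f j) hj.2 (mem_convexHull_triple (a := o) (b := f i) (c := f k) ?_ ?_ ?_
        (hor i k (hij.trans hjk)) ?_ (hor j k hjk).le (hor i j hij).le)
      · simp [ho, hj.1.symm]
      · simp [(Finset.mem_erase.1 (hfT i)).2, hfi.ne hij.ne]
      · simp [(Finset.mem_erase.1 (hfT k)).2, hfi.ne hjk.ne']
      · have : orient (f j) (f i) (f k) = -orient (f i) (f j) (f k) := by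
          simp only [orient, cross, Prod.fst_sub, Prod.snd_sub]; ring
        linarith
  · rw [Fin.range_cons]
    refine Set.Subset.antisymm (Set.insert_subset ho ?_) fun p hp => ?_
    · rintro _ ⟨i, rfl⟩
      exact (Finset.mem_erase.1 (hfT i)).2
    · by_cases hpo : p = o
      · exact Or.inl hpo
      · have hp' : p ∈ T.erase o := Finset.mem_erase.2 ⟨hpo, hp⟩
        have : pseudoAngle (p - o) ∈ Set.range e := by
          rw [he, Finset.range_orderEmbOfFin]
          exact Finset.mem_coe.2 (Finset.mem_image_of_mem _ hp')
        obtain ⟨i, hi⟩ := this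
        exact Or.inr ⟨i, hinj (hfT i) hp' (by simp only [hfe, hi])⟩

theorem ConvexChain.strictlyConvexCycle {m : ℕ} {q : Fin (m + 1) → ℝ × ℝ} (h : ConvexChain q) :
    StrictlyConvexCycle q := by
  intro i k
  refine Fin.lastCases (fun h1 h2 => ?_) (fun j h1 h2 => ?_) i
  · rw [Fin.last_add_one] at h2 ⊢
    rw [← orient_rotate]
    exact h 0 k _ (Fin.pos_iff_ne_zero.2 h2) (Fin.lt_last_iff_ne_last.2 h1)
  · rw [Fin.coeSucc_eq_succ] at h2 ⊢
    rcases lt_or_gt_of_ne h1 with hk | hk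
    · rw [orient_rotate]
      exact h _ _ _ hk (Fin.castSucc_lt_succ)
    · refine h _ _ _ (Fin.castSucc_lt_succ) (lt_of_le_of_ne ?_ h2.symm)
      exact Fin.castSucc_lt_iff_succ_le.1 hk

theorem volume_real_standard_open_triangle :
    volume.real {x : ℝ × ℝ | 0 < x.1 ∧ 0 < x.2 ∧ x.1 + x.2 < 1} = 1 / 2 := by
  have h : {x : ℝ × ℝ | 0 < x.1 ∧ 0 < x.2 ∧ x.1 + x.2 < 1} =
      regionBetween (fun _ => 0) (fun x => 1 - x) (Set.Ioc (0 : ℝ) 1) := by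
    ext ⟨x, y⟩
    simp only [regionBetween, Set.mem_ofPred_eq, Set.mem_Ioc, Set.mem_Ioo]
    constructor <;> intro h <;> refine ⟨?_, ?_⟩ <;> grind
  rw [h, measureReal_def, Measure.volume_eq_prod, volume_regionBetween_eq_integral]
  · rw [ENNReal.toReal_ofReal]
    · rw [← intervalIntegral.integral_of_le zero_le_one]
      simp only [sub_zero, Pi.sub_apply]
      rw [intervalIntegral.integral_sub (by simp) (by simp)]
      norm_num
    · refine setIntegral_nonneg measurableSet_Ioc fun x hx => ?_
      simpa using hx.2
  · exact (integrableOn_const (by simp))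
  · exact ContinuousOn.integrableOn_Icc (by fun_prop) |>.mono_set Set.Ioc_subset_Icc_self
  · exact measurableSet_Ioc
  · intro x hx
    simpa using hx.2

theorem volume_real_standard_closed_triangle_le :
    volume.real {x : ℝ × ℝ | 0 ≤ x.1 ∧ 0 ≤ x.2 ∧ x.1 + x.2 ≤ 1} ≤ 1 / 2 := by
  set C := {x : ℝ × ℝ | 0 ≤ x.1 ∧ 0 ≤ x.2 ∧ x.1 + x.2 ≤ 1}
  set O := {x : ℝ × ℝ | 0 < x.1 ∧ 0 < x.2 ∧ x.1 + x.2 < 1}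
  set R := (fun x : ℝ × ℝ => (1, 1) - x) ⁻¹' O
  have hR : volume.real R = 1 / 2 := by
    rw [← volume_real_standard_open_triangle, measureReal_def, measureReal_def]
    congr 1
    exact MeasurePreserving.measure_preimage_equiv
      (f := MeasurableEquiv.subLeft ((1, 1) : ℝ × ℝ))
      (Measure.measurePreserving_sub_left volume _) O
  have hO : IsOpen O := by
    refine (isOpen_lt continuous_const continuous_fst).inter
      ((isOpen_lt continuous_const continuous_snd).inter (isOpen_lt (continuous_fst.add continuous_snd) continuous_const))
  have hRm : MeasurableSet R := (hO.preimage (by fun_prop)).measurableSet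
  have hdisj : Disjoint C R := by
    rw [Set.disjoint_left]
    rintro ⟨x, y⟩ h1 h2
    simp only [C, O, R, Set.mem_ofPred_eq, Set.mem_preimage, Prod.mk_sub_mk] at h1 h2
    linarith [h1.2.2, h2.2.2]
  have hsub : C ∪ R ⊆ Set.Icc (0 : ℝ) 1 ×ˢ Set.Icc (0 : ℝ) 1 := by
    rintro ⟨x, y⟩ (h | h) <;>
    simp only [C, O, R, Set.mem_ofPred_eq, Set.mem_preimage, Prod.mk_sub_mk, Set.mem_prod,
      Set.mem_Icc] at h ⊢ <;> grind
  have hfin : volume (Set.Icc (0 : ℝ) 1 ×ˢ Set.Icc (0 : ℝ) 1) ≠ ⊤ := by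
    rw [Measure.volume_eq_prod, Measure.prod_prod]; simp
  have h1 : volume.real (C ∪ R) = volume.real C + volume.real R :=
    measureReal_union hdisj hRm
      (ne_top_of_le_ne_top hfin (measure_mono (Set.subset_union_left.trans hsub)))
      (ne_top_of_le_ne_top hfin (measure_mono (Set.subset_union_right.trans hsub)))
  have h2 := measureReal_mono hsub hfin
  have h3 : volume.real (Set.Icc (0 : ℝ) 1 ×ˢ Set.Icc (0 : ℝ) 1) = 1 := by
    rw [measureReal_def, Measure.volume_eq_prod, Measure.prod_prod]; simp
  linarith

/-- Passing to affine coordinates adapted to the triangle `p q r` scales areas. -/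
theorem volume_real_triangle_image {p q r : ℝ × ℝ} (h : 0 < orient p q r) (s : Set (ℝ × ℝ)) :
    volume.real {x | (orient r p x / orient p q r, orient p q x / orient p q r) ∈ s} =
      orient p q r * volume.real s := by
  set L := Matrix.toLin (Module.Basis.finTwoProd ℝ) (Module.Basis.finTwoProd ℝ)
    !![q.1 - p.1, r.1 - p.1; q.2 - p.2, r.2 - p.2]
  have hdet : LinearMap.det L = orient p q r := by
    rw [LinearMap.det_toLin, Matrix.det_fin_two_of]
    simp only [orient, cross, Prod.fst_sub, Prod.snd_sub]; ring
  have himg : {x | (orient r p x / orient p q r, orient p q x / orient p q r) ∈ s} =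
      (fun x => p + x) '' (L '' s) := by
    ext x
    simp only [Set.mem_ofPred_eq, Set.image_image, Set.mem_image]
    constructor
    · intro hx
      refine ⟨_, hx, ?_⟩
      have := h.ne'
      ext <;> simp only [L, Matrix.toLin_finTwoProd_apply, Prod.fst_add, Prod.snd_add] <;>
        field_simp <;> simp only [orient, cross, Prod.fst_sub, Prod.snd_sub] <;> ring
    · rintro ⟨⟨a, b⟩, hy, rfl⟩
      convert hy using 2 <;> rw [div_eq_iff h.ne'] <;>
      simp only [L, Matrix.toLin_finTwoProd_apply, Prod.fst_add, Prod.snd_add, orient, cross,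
        Prod.fst_sub, Prod.snd_sub] <;> ring
  rw [himg, measureReal_def, measureReal_def, Set.image_add_left, measure_preimage_add, Measure.addHaar_image_linearMap, hdet,
    abs_of_pos h, ENNReal.toReal_mul, ENNReal.toReal_ofReal h.le]

theorem orient_nonneg_of_mem_convexHull {p q x : ℝ × ℝ} {s : Set (ℝ × ℝ)}
    (h : ∀ y ∈ s, 0 ≤ orient p q y) (hx : x ∈ convexHull ℝ s) : 0 ≤ orient p q x := by
  refine convexHull_min (t := {y | 0 ≤ orient p q y}) h ?_ hx
  intro y hy z hz a b ha hb hab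
  have e : orient p q (a • y + b • z) = a * orient p q y + b * orient p q z := by
    obtain rfl : a = 1 - b := by linarith
    simp only [orient, cross, Prod.fst_sub, Prod.snd_sub, Prod.fst_add, Prod.snd_add,
      Prod.smul_fst, Prod.smul_snd, smul_eq_mul]
    ring
  simp only [Set.mem_ofPred_eq] at hy hz ⊢
  rw [e]
  positivity

theorem orient_swap (p q r : ℝ × ℝ) : orient q p r = -orient p q r := by
  simp only [orient, cross, Prod.fst_sub, Prod.snd_sub]
  ring

theorem orient_add_orient_add_orient (p q r x : ℝ × ℝ) :
    orient p q x + orient q r x + orient r p x = orient p q r := by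
  simp only [orient, cross, Prod.fst_sub, Prod.snd_sub]
  ring

theorem mem_convexHull_of_orient_nonneg {p q r x : ℝ × ℝ} {s : Set (ℝ × ℝ)} (hp : p ∈ s)
    (hq : q ∈ s) (hr : r ∈ s) (h : 0 < orient p q r)
    (hx : 0 ≤ orient r p x ∧ 0 ≤ orient p q x ∧ 0 ≤ orient q r x) : x ∈ convexHull ℝ s := by
  refine mem_convexHull_triple hp hq hr h ?_ ?_ hx.2.1
  · rw [← orient_rotate]
    exact hx.2.2
  · rw [orient_rotate]
    exact hx.1

theorem isOpen_open_triangle (p q r : ℝ × ℝ) :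
    IsOpen {x | 0 < orient r p x ∧ 0 < orient p q x ∧ 0 < orient q r x} := by
  have hc : ∀ u v : ℝ × ℝ, Continuous (orient u v) := fun u v => by
    unfold orient cross
    fun_prop
  exact (isOpen_lt continuous_const (hc _ _)).inter
    ((isOpen_lt continuous_const (hc _ _)).inter (isOpen_lt continuous_const (hc _ _)))

theorem volume_real_open_triangle {p q r : ℝ × ℝ} (h : 0 < orient p q r) :
    volume.real {x | 0 < orient r p x ∧ 0 < orient p q x ∧ 0 < orient q r x} =
      orient p q r / 2 := by
  have e : {x | 0 < orient r p x ∧ 0 < orient p q x ∧ 0 < orient q r x} =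
      {x | (orient r p x / orient p q r, orient p q x / orient p q r) ∈
        {x : ℝ × ℝ | 0 < x.1 ∧ 0 < x.2 ∧ x.1 + x.2 < 1}} := by
    ext x
    simp only [Set.mem_ofPred_eq]
    rw [div_pos_iff_of_pos_right h, div_pos_iff_of_pos_right h, ← add_div, div_lt_one h,
      ← orient_add_orient_add_orient p q r x]
    grind
  rw [e, volume_real_triangle_image h, volume_real_standard_open_triangle]
  ring

theorem volume_convexHull_ne_top {s : Set (ℝ × ℝ)} (hs : s.Finite) :
    volume (convexHull ℝ s) ≠ ⊤ :=
  ((isBounded_convexHull.2 hs.isBounded).measure_lt_top).ne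

theorem shoelace_succ {m : ℕ} (q : Fin (m + 2) → ℝ × ℝ) :
    shoelace q = shoelace (fun i : Fin (m + 1) => q i.castSucc) +
      orient (q 0) (q (Fin.last m).castSucc) (q (Fin.last (m + 1))) := by
  rw [shoelace, shoelace, Fin.sum_univ_castSucc, Fin.sum_univ_castSucc, Fin.sum_univ_castSucc]
  simp only [Fin.coeSucc_eq_succ, Fin.last_add_one, Fin.succ_castSucc, Fin.succ_last,
    Fin.castSucc_zero]
  simp only [orient, cross, Prod.fst_sub, Prod.snd_sub]
  ring

theorem ConvexChain.shoelace_le {m : ℕ} {q : Fin (m + 1) → ℝ × ℝ} (h : ConvexChain q) :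
    shoelace q ≤ 2 * volume.real (convexHull ℝ (Set.range q)) := by
  induction m with
  | zero =>
    have : shoelace q = 0 := by
      simp [shoelace, cross]
      ring
    rw [this]
    positivity
  | succ m ih =>
    have hsub : Set.range (fun i : Fin (m + 1) => q i.castSucc) ⊆ Set.range q := by
      rintro _ ⟨i, rfl⟩
      exact ⟨_, rfl⟩
    have hmono := convexHull_mono (𝕜 := ℝ) hsub
    have hfin := volume_convexHull_ne_top (Set.finite_range q)
    have hi := ih (q := fun i => q i.castSucc) fun i j k hij hjk =>
      h _ _ _ (Fin.castSucc_lt_castSucc_iff.2 hij) (Fin.castSucc_lt_castSucc_iff.2 hjk)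
    rw [shoelace_succ]
    rcases Nat.eq_zero_or_pos m with rfl | hm
    · have : orient (q 0) (q (Fin.last 0).castSucc) (q (Fin.last (0 + 1))) = 0 := by
        simp [orient, cross]
      have := measureReal_mono hmono hfin
      linarith
    have hl : (0 : Fin (m + 2)) < (Fin.last m).castSucc := by
      rw [Fin.lt_def]
      simpa using hm
    have hD := h 0 _ (Fin.last (m + 1)) hl (Fin.castSucc_lt_last _)
    set a := q 0
    set b := q (Fin.last m).castSucc
    set c := q (Fin.last (m + 1))
    set T := {x | 0 < orient c a x ∧ 0 < orient a b x ∧ 0 < orient b c x}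
    have hTvol : volume.real T = orient a b c / 2 := volume_real_open_triangle hD
    have hTopen : IsOpen T := isOpen_open_triangle a b c
    have hTsub : T ⊆ convexHull ℝ (Set.range q) := fun x hx =>
      mem_convexHull_of_orient_nonneg (p := a) (q := b) (r := c) ⟨_, rfl⟩ ⟨_, rfl⟩ ⟨_, rfl⟩ hD
        ⟨hx.1.le, hx.2.1.le, hx.2.2.le⟩
    have hdisj : Disjoint (convexHull ℝ (Set.range fun i : Fin (m + 1) => q i.castSucc)) T := by
      rw [Set.disjoint_left]
      intro x hx hxT
      have := orient_nonneg_of_mem_convexHull (p := b) (q := a) ?_ hx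
      · rw [orient_swap] at this
        linarith [hxT.2.1]
      rintro _ ⟨i, rfl⟩
      rcases eq_or_ne i 0 with rfl | hi0
      · apply le_of_eq
        simp only [orient, cross, a, Fin.castSucc_zero, Prod.fst_sub, Prod.snd_sub]
        ring
      rcases eq_or_ne i (Fin.last m) with rfl | him
      · apply le_of_eq
        simp only [orient, cross, b, Prod.fst_sub, Prod.snd_sub]
        ring
      rw [← orient_rotate]
      exact (h 0 _ _ (by
        rw [Fin.lt_def]
        simpa using Fin.pos_iff_ne_zero.2 hi0)
        (Fin.castSucc_lt_castSucc_iff.2 (Fin.lt_last_iff_ne_last.2 him))).le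
    have h1 := measureReal_mono (Set.union_subset hmono hTsub) hfin
    rw [measureReal_union hdisj hTopen.measurableSet
      (ne_top_of_le_ne_top hfin (measure_mono hmono))
      (ne_top_of_le_ne_top hfin (measure_mono hTsub)), hTvol] at h1
    linarith

theorem StrictlyConvexCycle.shoelace_pos_six {A : Fin 6 → ℝ × ℝ} (h : StrictlyConvexCycle A) :
    0 < shoelace A := by
  have h1 : 0 < orient (A 0) (A 1) (A 2) := h 0 2 (by decide) (by decide)
  have h2 : 0 < orient (A 2) (A 3) (A 0) := h 2 0 (by decide) (by decide)
  have h3 : 0 < orient (A 3) (A 4) (A 0) := h 3 0 (by decide) (by decide)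
  have h4 : 0 < orient (A 4) (A 5) (A 0) := h 4 0 (by decide) (by decide)
  have : shoelace A = orient (A 0) (A 1) (A 2) + orient (A 2) (A 3) (A 0) +
      orient (A 3) (A 4) (A 0) + orient (A 4) (A 5) (A 0) := by
    rw [shoelace_six]
    simp only [orient, cross, Prod.fst_sub, Prod.snd_sub]
    ring
  linarith

theorem mem_convexHull_or_mem_triangle {a b X z : ℝ × ℝ} {V : Set (ℝ × ℝ)} (hV : V.Nonempty)
    (hab : ∀ w ∈ V, 0 ≤ orient a b w) (haX : ∀ w ∈ V, 0 ≤ orient a X w)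
    (hXb : ∀ w ∈ V, 0 ≤ orient X b w) (hX : 0 < orient a X b)
    (hz : z ∈ convexHull ℝ (insert X V)) :
    z ∈ convexHull ℝ (insert a (insert b V)) ∨
      0 ≤ orient b a z ∧ 0 ≤ orient a X z ∧ 0 ≤ orient X b z := by
  have h1 : 0 ≤ orient a X z := by
    refine orient_nonneg_of_mem_convexHull (fun y hy => ?_) hz
    rcases hy with rfl | hy
    · simp [orient, cross, mul_comm]
    · exact haX y hy
  have h2 : 0 ≤ orient X b z := by
    refine orient_nonneg_of_mem_convexHull (fun y hy => ?_) hz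
    rcases hy with rfl | hy
    · simp [orient, cross]
    · exact hXb y hy
  rcases le_or_gt 0 (orient b a z) with h3 | h3
  · exact Or.inr ⟨h3, h1, h2⟩
  left
  rw [orient_swap, neg_lt_zero] at h3
  rw [convexHull_insert hV, mem_convexJoin] at hz
  obtain ⟨x, rfl, w, hw, hzw⟩ := hz
  obtain ⟨s, t, hs, ht, hst, rfl⟩ := hzw
  have e0 : orient a b (s • x + t • w) = t * orient a b w - s * orient a x b := by
    obtain rfl : s = 1 - t := by linarith
    simp only [orient, cross, Prod.fst_sub, Prod.snd_sub, Prod.fst_add, Prod.snd_add,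
      Prod.smul_fst, Prod.smul_snd, smul_eq_mul]
    ring
  have e1 : orient a (s • x + t • w) w = s * orient a x w := by
    obtain rfl : s = 1 - t := by linarith
    simp only [orient, cross, Prod.fst_sub, Prod.snd_sub, Prod.fst_add, Prod.snd_add,
      Prod.smul_fst, Prod.smul_snd, smul_eq_mul]
    ring
  have e2 : orient (s • x + t • w) b w = s * orient x b w := by
    obtain rfl : s = 1 - t := by linarith
    simp only [orient, cross, Prod.fst_sub, Prod.snd_sub, Prod.fst_add, Prod.snd_add,
      Prod.smul_fst, Prod.smul_snd, smul_eq_mul]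
    ring
  have w0 := orient_nonneg_of_mem_convexHull hab hw
  have w0' : 0 < orient a b w := by
    refine lt_of_le_of_ne w0 fun h => ?_
    rw [e0, ← h] at h3
    nlinarith
  set K := convexHull ℝ (insert a (insert b V))
  have hK : convexHull ℝ K = K := (convex_convexHull ℝ _).convexHull_eq
  rw [← hK]
  refine mem_convexHull_triple (subset_convexHull ℝ _ (Set.mem_insert _ _))
    (subset_convexHull ℝ _ (Set.mem_insert_of_mem _ (Set.mem_insert _ _)))
    (convexHull_mono (fun y hy => Set.mem_insert_of_mem _ (Set.mem_insert_of_mem _ hy)) hw)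
    w0' ?_ ?_ h3.le
  · rw [e2]
    exact mul_nonneg hs (orient_nonneg_of_mem_convexHull hXb hw)
  · rw [e1]
    exact mul_nonneg hs (orient_nonneg_of_mem_convexHull haX hw)

theorem volume_real_closed_triangle_le {p q r : ℝ × ℝ} (h : 0 < orient p q r) :
    volume.real {x | 0 ≤ orient r p x ∧ 0 ≤ orient p q x ∧ 0 ≤ orient q r x} ≤
      orient p q r / 2 := by
  have e : {x | 0 ≤ orient r p x ∧ 0 ≤ orient p q x ∧ 0 ≤ orient q r x} =
      {x | (orient r p x / orient p q r, orient p q x / orient p q r) ∈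
        {x : ℝ × ℝ | 0 ≤ x.1 ∧ 0 ≤ x.2 ∧ x.1 + x.2 ≤ 1}} := by
    ext x
    simp only [Set.mem_ofPred_eq]
    rw [le_div_iff₀ h, le_div_iff₀ h, ← add_div, div_le_one h,
      ← orient_add_orient_add_orient p q r x]
    grind
  rw [e, volume_real_triangle_image h]
  linarith [mul_le_mul_of_nonneg_left volume_real_standard_closed_triangle_le h.le]

theorem StrictlyConvexCycle.exists_circumscribed_pentagon {A : Fin 6 → ℝ × ℝ}
    (h : StrictlyConvexCycle A) (ht : 0 < turn A 0) :
    ∃ W : Finset (ℝ × ℝ), W.card ≤ 5 ∧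
      convexHull ℝ (Set.range A) ⊆ convexHull ℝ (W : Set (ℝ × ℝ)) ∧
      volume.real (convexHull ℝ (W : Set (ℝ × ℝ))) ≤
        volume.real (convexHull ℝ (Set.range A)) + ear A 0 * ear A 1 / turn A 0 / 2 := by
  classical
  have h0 := h.ear_pos_six 0
  have h1 := h.ear_pos_six 1
  have ht' : turn A 0 = cross (A 0 - A 5) (A 2 - A 1) := rfl
  have e0 : ear A 0 = orient (A 5) (A 0) (A 1) := rfl
  have e1 : ear A 1 = orient (A 0) (A 1) (A 2) := rfl
  set l := ear A 1 / turn A 0 with hl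
  set k := ear A 0 / turn A 0 with hk
  have hl0 : 0 < l := div_pos h1 ht
  have hk0 : 0 < k := div_pos h0 ht
  set X := A 0 + l • (A 0 - A 5) with hX
  have hX' : X = A 1 - k • (A 2 - A 1) := by
    have : turn A 0 • (A 1 - A 0) = ear A 1 • (A 0 - A 5) + ear A 0 • (A 2 - A 1) := by
      rw [ht', e0, e1]
      ext <;> simp only [orient, cross, Prod.fst_sub, Prod.snd_sub, Prod.smul_fst, Prod.smul_snd,
        Prod.fst_add, Prod.snd_add, smul_eq_mul] <;> ring
    have h3 : A 1 - A 0 = l • (A 0 - A 5) + k • (A 2 - A 1) := by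
      rw [hl, hk, div_eq_inv_mul, div_eq_inv_mul, mul_smul, mul_smul, ← smul_add, ← this,
        inv_smul_smul₀ ht.ne']
    rw [hX, eq_sub_iff_add_eq, add_assoc, ← h3]
    abel
  have o1 : ∀ w, orient (A 0) X w = l * orient (A 5) (A 0) w := fun w => by
    rw [hX]
    simp only [orient, cross, Prod.fst_sub, Prod.snd_sub, Prod.smul_fst, Prod.smul_snd,
      Prod.fst_add, Prod.snd_add, smul_eq_mul]
    ring
  have o2 : ∀ w, orient X (A 1) w = k * orient (A 1) (A 2) w := fun w => by
    rw [hX']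
    simp only [orient, cross, Prod.fst_sub, Prod.snd_sub, Prod.smul_fst, Prod.smul_snd,
      smul_eq_mul]
    ring
  have oX : orient (A 0) X (A 1) = ear A 0 * ear A 1 / turn A 0 := by
    rw [o1, ← e0, hl]
    ring
  have oX0 : 0 < orient (A 0) X (A 1) := by
    rw [oX]
    positivity
  have self : ∀ u v : ℝ × ℝ, orient u v u = 0 ∧ orient u v v = 0 := fun u v => by
    constructor <;> simp only [orient, cross, Prod.fst_sub, Prod.snd_sub] <;> ring
  refine ⟨{X, A 2, A 3, A 4, A 5}, Finset.card_le_five, ?_, ?_⟩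
  · refine convexHull_min ?_ (convex_convexHull ℝ _)
    rintro _ ⟨i, rfl⟩
    fin_cases i
    · refine mem_convexHull_of_smul_eq (a := A 5) (b := X) (r := 1) (t := 1 + l) (by simp)
        (by simp) zero_le_one (by positivity) (by linarith) ?_
      rw [hX]
      simp only [Fin.zero_eta]
      module
    · refine mem_convexHull_of_smul_eq (a := A 2) (b := X) (r := 1) (t := 1 + k) (by simp)
        (by simp) zero_le_one (by positivity) (by linarith) ?_
      rw [hX']
      simp only [Fin.mk_one]
      module
    all_goals exact subset_convexHull ℝ _ (by simp)
  · have hV : ∀ w ∈ ({A 2, A 3, A 4, A 5} : Set (ℝ × ℝ)), 0 ≤ orient (A 0) (A 1) w ∧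
        0 ≤ orient (A 5) (A 0) w ∧ 0 ≤ orient (A 1) (A 2) w := by
      have hA : ∀ i k : Fin 6, 0 ≤ orient (A i) (A (i + 1)) (A k) := fun i k => by
        by_cases h1 : k = i
        · exact h1 ▸ (self _ _).1.ge
        by_cases h2 : k = i + 1
        · exact h2 ▸ (self _ _).2.ge
        exact (h i k h1 h2).le
      rintro w (rfl | rfl | rfl | rfl) <;> exact ⟨hA 0 _, hA 5 _, hA 1 _⟩
    set V : Set (ℝ × ℝ) := {A 2, A 3, A 4, A 5}
    set P := convexHull ℝ (Set.range A)
    set T := {x | 0 ≤ orient (A 1) (A 0) x ∧ 0 ≤ orient (A 0) X x ∧ 0 ≤ orient X (A 1) x}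
    have hsub : convexHull ℝ (({X, A 2, A 3, A 4, A 5} : Finset (ℝ × ℝ)) : Set (ℝ × ℝ)) ⊆
        P ∪ T := by
      intro z hz
      refine (mem_convexHull_or_mem_triangle (a := A 0) (b := A 1) (X := X) (V := V)
        ⟨A 2, by simp [V]⟩ (fun w hw => (hV w hw).1)
        (fun w hw => ?_) (fun w hw => ?_) oX0 (by simpa [V] using hz)).imp (fun hzP => ?_) id
      · rw [o1]
        exact mul_nonneg hl0.le (hV w hw).2.1
      · rw [o2]
        exact mul_nonneg hk0.le (hV w hw).2.2
      · refine convexHull_mono ?_ hzP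
        rintro w (rfl | rfl | rfl | rfl | rfl | rfl) <;> exact ⟨_, rfl⟩
    have hTfin : volume T ≠ ⊤ := by
      refine ne_top_of_le_ne_top
        (volume_convexHull_ne_top (s := {A 0, X, A 1}) (Set.toFinite _)) (measure_mono ?_)
      exact fun x hx => mem_convexHull_of_orient_nonneg (p := A 0) (q := X) (r := A 1) (by simp)
        (by simp) (by simp) oX0 hx
    have hPfin : volume P ≠ ⊤ := volume_convexHull_ne_top (Set.finite_range A)
    have hT : volume.real T ≤ orient (A 0) X (A 1) / 2 := volume_real_closed_triangle_le oX0
    rw [← oX]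
    have := measureReal_mono hsub (measure_union_ne_top hPfin hTfin)
    have := measureReal_union_le (μ := volume) P T
    linarith

theorem StrictlyConvexCycle.exists_pentagon_volume_le {A : Fin 6 → ℝ × ℝ}
    (h : StrictlyConvexCycle A)
    (hA : shoelace A ≤ 2 * volume.real (convexHull ℝ (Set.range A))) :
    ∃ W : Finset (ℝ × ℝ), W.card ≤ 5 ∧
      convexHull ℝ (Set.range A) ⊆ convexHull ℝ (W : Set (ℝ × ℝ)) ∧
      volume.real (convexHull ℝ (W : Set (ℝ × ℝ))) ≤
        7 / 6 * volume.real (convexHull ℝ (Set.range A)) := by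
  obtain ⟨i, hi, hle⟩ := h.exists_removable_side h.shoelace_pos_six
  have ht : turn (fun j => A (j + i)) 0 = turn A i := by
    clear hi hle
    fin_cases i <;> rfl
  have h0 : ear (fun j => A (j + i)) 0 = ear A i := by
    clear hi hle ht
    fin_cases i <;> rfl
  have h1 : ear (fun j => A (j + i)) 1 = ear A (i + 1) := by
    clear hi hle ht
    fin_cases i <;> rfl
  have hr : Set.range (fun j => A (j + i)) = Set.range A :=
    (Equiv.addRight i).surjective.range_comp A
  obtain ⟨W, hW, hsub, hvol⟩ := (h.rotate i).exists_circumscribed_pentagon (by rwa [ht])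
  rw [hr] at hsub hvol
  refine ⟨W, hW, hsub, ?_⟩
  rw [h0, h1, ht] at hvol
  have : ear A i * ear A (i + 1) / turn A i ≤ shoelace A / 6 := by
    rw [div_le_iff₀ hi]
    linarith
  linarith

theorem exists_pentagon_volume_le {S : Finset (ℝ × ℝ)} (hS : S.card ≤ 6) :
    ∃ W : Finset (ℝ × ℝ), W.card ≤ 5 ∧
      convexHull ℝ (S : Set (ℝ × ℝ)) ⊆ convexHull ℝ (W : Set (ℝ × ℝ)) ∧
      volume.real (convexHull ℝ (W : Set (ℝ × ℝ))) ≤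
        7 / 6 * volume.real (convexHull ℝ (S : Set (ℝ × ℝ))) := by
  obtain ⟨T, hTS, hT, hconv⟩ := exists_convexPosition_subset S
  have hTc := (Finset.card_le_card hTS).trans hS
  rcases hTc.lt_or_eq with h5 | h6
  · refine ⟨T, by omega, hT.ge, ?_⟩
    rw [hT]
    have : 0 ≤ volume.real (convexHull ℝ (S : Set (ℝ × ℝ))) := measureReal_nonneg
    linarith
  · obtain ⟨q, hq, hr⟩ := exists_convexChain hconv (m := 5) h6
    rw [← hT, ← hr]
    exact hq.strictlyConvexCycle.exists_pentagon_volume_le hq.shoelace_le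

/-- The linear map of order six permuting cyclically the vertices of the hexagon
`|x| ≤ 1`, `|y| ≤ 1`, `|x + y| ≤ 1`. -/
def sixthTurn (v : ℝ × ℝ) : ℝ × ℝ := (-v.2, v.1 + v.2)

theorem cross_sixthTurn (u v : ℝ × ℝ) : cross (sixthTurn u) (sixthTurn v) = cross u v := by
  simp only [cross, sixthTurn]
  ring

theorem cross_sixthTurn_iterate (k : ℕ) (u v : ℝ × ℝ) :
    cross (sixthTurn^[k] u) (sixthTurn^[k] v) = cross u v := by
  induction k generalizing u v with
  | zero => rfl
  | succ k ih => rw [Function.iterate_succ_apply, Function.iterate_succ_apply, ih, cross_sixthTurn]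

theorem sixthTurn_iterate_six (v : ℝ × ℝ) : sixthTurn^[6] v = v := by
  ext <;> simp [sixthTurn]

theorem sixthTurn_iterate_sub (k : ℕ) (u v : ℝ × ℝ) :
    sixthTurn^[k] (u - v) = sixthTurn^[k] u - sixthTurn^[k] v := by
  induction k generalizing u v with
  | zero => rfl
  | succ k ih =>
    simp only [Function.iterate_succ_apply, ← ih]
    congr 1
    ext <;> simp only [sixthTurn, Prod.fst_sub, Prod.snd_sub] <;> ring

theorem exists_sixthTurn_iterate_eq (e : ℝ × ℝ) (he : e ≠ 0) :
    ∃ k < 6, ∃ c > (0 : ℝ), ∃ t : ℝ, 0 ≤ t ∧ t < 1 ∧ e = c • sixthTurn^[k] (1 - t, t) := by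
  have key : ∀ k < 6, ∀ a b : ℝ, 0 < a → 0 ≤ b → e = sixthTurn^[k] (a, b) →
      ∃ k < 6, ∃ c > (0 : ℝ), ∃ t : ℝ, 0 ≤ t ∧ t < 1 ∧ e = c • sixthTurn^[k] (1 - t, t) := by
    intro k hk a b ha hb h
    have hab : 0 < a + b := by linarith
    refine ⟨k, hk, a + b, hab, b / (a + b), by positivity, (div_lt_one hab).2 (by linarith), ?_⟩
    rw [h]
    have h1 : a = (a + b) * (1 - b / (a + b)) := by field_simp; ring
    have h2 : b = (a + b) * (b / (a + b)) := by field_simp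
    clear h
    generalize a + b = c at *
    generalize b / c = t at *
    subst h1 h2
    induction k with
    | zero => simp
    | succ k ih =>
      rw [Function.iterate_succ_apply', Function.iterate_succ_apply', ih (by omega)]
      ext <;> simp only [sixthTurn, Prod.smul_fst, Prod.smul_snd, smul_eq_mul] <;> ring
  obtain ⟨x, y⟩ := e
  by_cases h0 : 0 < x ∧ 0 ≤ y
  · exact key 0 (by norm_num) x y h0.1 h0.2 rfl
  by_cases h1 : 0 < x + y ∧ 0 ≤ -x
  · exact key 1 (by norm_num) _ _ h1.1 h1.2 (by ext <;> simp [sixthTurn])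
  by_cases h2 : 0 < y ∧ 0 ≤ -x - y
  · exact key 2 (by norm_num) _ _ h2.1 h2.2 (by ext <;> simp [sixthTurn])
  by_cases h3 : 0 < -x ∧ 0 ≤ -y
  · exact key 3 (by norm_num) _ _ h3.1 h3.2 (by ext <;> simp [sixthTurn])
  by_cases h4 : 0 < -x - y ∧ 0 ≤ x
  · exact key 4 (by norm_num) _ _ h4.1 h4.2 (by ext <;> simp [sixthTurn])
  by_cases h5 : 0 < -y ∧ 0 ≤ x + y
  · exact key 5 (by norm_num) _ _ h5.1 h5.2 (by ext <;> simp [sixthTurn])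
  refine absurd ?_ he
  ext <;> simp <;> grind

theorem corner_area_aux {d : ℕ} (hd : d < 6) {t t' : ℝ} (ht0 : 0 ≤ t) (ht1 : t < 1)
    (ht0' : 0 ≤ t') (ht1' : t' < 1) {p : ℝ × ℝ}
    (hD : 0 < cross (1 - t, t) (sixthTurn^[d] (1 - t', t')))
    (h1 : 0 ≤ cross (p - (1, -1)) (1 - t, t))
    (h2 : 0 ≤ cross (p - sixthTurn^[d] (1, -1)) (sixthTurn^[d] (1 - t', t'))) :
    2 * d + t' - t - 1 ≤ cross (1, -1) p + cross p (sixthTurn^[d] (1, -1)) := by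
  obtain ⟨x, y⟩ := p
  refine le_of_mul_le_mul_left ?_ hD
  have s1 : 0 < 1 - t := by linarith
  have s1' : 0 < 1 - t' := by linarith
  have tt := mul_nonneg ht0 ht0'
  have ts := mul_nonneg ht0 s1'.le
  have st := mul_nonneg s1.le ht0'
  have ss := mul_pos s1 s1'
  interval_cases d <;> simp only [Function.iterate_zero, id_eq, Function.iterate_succ_apply,
    sixthTurn, cross, Prod.mk_sub_mk, Nat.cast_ofNat, Nat.cast_zero, Nat.cast_one] at *
  · nlinarith
  · nlinarith [mul_nonneg ht0' h1, mul_nonneg s1.le h2, mul_nonneg st s1.le]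
  · nlinarith [mul_nonneg ht0' h1, mul_nonneg s1.le h2]
  · nlinarith
  · nlinarith
  · nlinarith

theorem corner_area {k k' : ℕ} (hk : k < 6) (hk' : k' < 6) {t t' : ℝ} (ht0 : 0 ≤ t) (ht1 : t < 1)
    (ht0' : 0 ≤ t') (ht1' : t' < 1) {q : ℝ × ℝ}
    (hD : 0 < cross (sixthTurn^[k] (1 - t, t)) (sixthTurn^[k'] (1 - t', t')))
    (h1 : 0 ≤ cross (q - sixthTurn^[k] (1, -1)) (sixthTurn^[k] (1 - t, t)))
    (h2 : 0 ≤ cross (q - sixthTurn^[k'] (1, -1)) (sixthTurn^[k'] (1 - t', t'))) :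
    (2 * k' + t') - (2 * k + t) - 1 + (if k' < k then 12 else 0) ≤
      cross (sixthTurn^[k] (1, -1)) q + cross q (sixthTurn^[k'] (1, -1)) := by
  obtain ⟨d, hd, hd', hiter⟩ : ∃ d : ℕ, d < 6 ∧ 2 * (d : ℝ) = 2 * k' - 2 * k + (if k' < k then 12 else 0) ∧
      ∀ v, sixthTurn^[k'] v = sixthTurn^[k] (sixthTurn^[d] v) := by
    split_ifs with h
    · refine ⟨k' + 6 - k, by omega, ?_, fun v => ?_⟩
      · rw [Nat.cast_sub (by omega)]
        push_cast
        ring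
      · rw [← Function.iterate_add_apply, show k + (k' + 6 - k) = k' + 6 by omega,
          Function.iterate_add_apply, sixthTurn_iterate_six]
    · refine ⟨k' - k, by omega, ?_, fun v => ?_⟩
      · rw [Nat.cast_sub (by omega)]
        ring
      · rw [← Function.iterate_add_apply, show k + (k' - k) = k' by omega]
  obtain ⟨p, rfl⟩ : ∃ p, q = sixthTurn^[k] p := by
    refine ⟨sixthTurn^[6 - k] q, ?_⟩
    rw [← Function.iterate_add_apply, show k + (6 - k) = 6 by omega, sixthTurn_iterate_six]
  simp only [hiter, ← sixthTurn_iterate_sub, cross_sixthTurn_iterate] at hD h1 h2 ⊢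
  linarith [corner_area_aux hd ht0 ht1 ht0' ht1' hD h1 h2]

theorem cross_smul_left (c : ℝ) (u v : ℝ × ℝ) : cross (c • u) v = c * cross u v := by
  simp only [cross, Prod.smul_fst, Prod.smul_snd, smul_eq_mul]
  ring

theorem cross_smul_right (c : ℝ) (u v : ℝ × ℝ) : cross u (c • v) = c * cross u v := by
  simp only [cross, Prod.smul_fst, Prod.smul_snd, smul_eq_mul]
  ring

theorem direction_lt_of_cross_pos {k k' : ℕ} (hk : k ≤ k') {t t' : ℝ} (ht1 : t < 1)
    (ht0' : 0 ≤ t')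
    (hD : 0 < cross (sixthTurn^[k] (1 - t, t)) (sixthTurn^[k'] (1 - t', t'))) :
    2 * k + t < 2 * k' + t' := by
  rcases hk.lt_or_eq with h | rfl
  · have : (k : ℝ) + 1 ≤ k' := by exact_mod_cast h
    linarith
  · rw [cross_sixthTurn_iterate] at hD
    simp only [cross] at hD
    linarith

/-- A cyclic sequence of points winding counterclockwise around the hexagon `|x| ≤ 1`, `|y| ≤ 1`,
`|x + y| ≤ 1` satisfies the following lower bound for the enclosed area. -/
theorem StrictlyConvexCycle.twelve_sub_le_shoelace {n : ℕ} [NeZero n] {A : Fin n → ℝ × ℝ}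
    (h : StrictlyConvexCycle A) (hn : 3 ≤ n)
    (hA : ∀ i k, 0 ≤ orient (A i) (A (i + 1)) (sixthTurn^[k] (1, -1))) :
    12 - (n : ℝ) ≤ shoelace A := by
  have one_ne : (1 : Fin n) ≠ 0 := by
    rw [Ne, Fin.ext_iff, Fin.val_one', Fin.val_zero, Nat.mod_eq_of_lt (by omega)]
    omega
  have two_ne : (1 : Fin n) + 1 ≠ 0 := by
    rw [Ne, Fin.ext_iff, Fin.val_add, Fin.val_one', Fin.val_zero,
      Nat.mod_eq_of_lt (show 1 < n by omega), Nat.mod_eq_of_lt (by omega)]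
    omega
  have hpos : ∀ i, 0 < cross (edge A i) (edge A (i + 1)) := fun i => by
    have := h i (i + 1 + 1) (by simpa [add_assoc] using two_ne) (by simpa using one_ne)
    convert this using 1
    simp only [edge, orient, cross, Prod.fst_sub, Prod.snd_sub]
    ring
  have hne : ∀ i, edge A i ≠ 0 := fun i hi => by
    have := hpos i
    rw [hi] at this
    simp [cross] at this
  choose k hk c hc t ht0 ht1 he using fun i => exists_sixthTurn_iterate_eq (edge A i) (hne i)
  have hD : ∀ i, 0 < cross (sixthTurn^[k i] (1 - t i, t i))
      (sixthTurn^[k (i + 1)] (1 - t (i + 1), t (i + 1))) := fun i => by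
    have := hpos i
    rw [he i, he (i + 1), cross_smul_left, cross_smul_right] at this
    exact pos_of_mul_pos_right (pos_of_mul_pos_right this (hc _).le) (hc _).le
  have hs : ∀ i j, 0 ≤ cross (A i - sixthTurn^[j] (1, -1)) (sixthTurn^[k i] (1 - t i, t i)) ∧
      0 ≤ cross (A (i + 1) - sixthTurn^[j] (1, -1)) (sixthTurn^[k i] (1 - t i, t i)) := by
    intro i j
    have h0 := hA i j
    have h1 : cross (A i - sixthTurn^[j] (1, -1)) (edge A i) =
        orient (A i) (A (i + 1)) (sixthTurn^[j] (1, -1)) := by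
      simp only [edge, orient, cross, Prod.fst_sub, Prod.snd_sub]
      ring
    have h2 : cross (A (i + 1) - sixthTurn^[j] (1, -1)) (edge A i) =
        orient (A i) (A (i + 1)) (sixthTurn^[j] (1, -1)) := by
      simp only [edge, orient, cross, Prod.fst_sub, Prod.snd_sub]
      ring
    rw [he i, cross_smul_right] at h1 h2
    exact ⟨nonneg_of_mul_nonneg_right (h1 ▸ h0) (hc i), nonneg_of_mul_nonneg_right (h2 ▸ h0) (hc i)⟩
  set m : Fin n → ℝ × ℝ := fun i => sixthTurn^[k i] (1, -1)
  set f : Fin n → ℝ := fun i => 2 * k i + t i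
  have hcorner : ∀ i, f (i + 1) - f i - 1 + (if k (i + 1) < k i then 12 else 0) ≤
      cross (m i) (A (i + 1)) + cross (A (i + 1)) (m (i + 1)) := fun i =>
    corner_area (hk i) (hk _) (ht0 i) (ht1 i) (ht0 _) (ht1 _) (hD i) (hs i _).2 (hs (i + 1) _).1
  have hshift : ∀ g : Fin n → ℝ, ∑ i, g (i + 1) = ∑ i, g i := fun g =>
    Fintype.sum_equiv (Equiv.addRight 1) _ _ fun i => rfl
  obtain ⟨i₀, hi₀⟩ : ∃ i, k (i + 1) < k i := by
    by_contra! hcon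
    have : ∑ i, f i < ∑ i, f (i + 1) := Finset.sum_lt_sum_of_nonempty ⟨0, Finset.mem_univ _⟩
      fun i _ => direction_lt_of_cross_pos (hcon i) (ht1 i) (ht0 _) (hD i)
    exact this.ne (hshift f).symm
  have hjump : (12 : ℝ) ≤ ∑ i, if k (i + 1) < k i then (12 : ℝ) else 0 := by
    have := Finset.single_le_sum (f := fun i => if k (i + 1) < k i then (12 : ℝ) else 0)
      (fun i _ => by split_ifs <;> norm_num) (Finset.mem_univ i₀)
    simpa [hi₀] using this
  have hsum := Finset.sum_le_sum fun i (_ : i ∈ Finset.univ) => hcorner i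
  simp only [Finset.sum_add_distrib, Finset.sum_sub_distrib, hshift f, Finset.sum_const,
    Finset.card_univ, Fintype.card_fin, nsmul_eq_mul, mul_one] at hsum
  rw [hshift fun i => cross (A i) (m i), ← Finset.sum_add_distrib] at hsum
  have harea : ∑ i, (cross (m i) (A (i + 1)) + cross (A i) (m i)) ≤ shoelace A := by
    refine Finset.sum_le_sum fun i _ => ?_
    have := hA i (k i)
    simp only [m]
    simp only [orient, cross, Prod.fst_sub, Prod.snd_sub] at this ⊢
    linarith
  linarith

theorem StrictlyConvexCycle.orient_nonneg {n : ℕ} [NeZero n] {A : Fin n → ℝ × ℝ}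
    (h : StrictlyConvexCycle A) (i : Fin n) {x : ℝ × ℝ} (hx : x ∈ convexHull ℝ (Set.range A)) :
    0 ≤ orient (A i) (A (i + 1)) x := by
  refine orient_nonneg_of_mem_convexHull ?_ hx
  rintro _ ⟨k, rfl⟩
  by_cases h1 : k = i
  · subst h1
    simp [orient, cross]
  by_cases h2 : k = i + 1
  · subst h2
    simp [orient, cross, mul_comm]
  exact (h i k h1 h2).le

theorem orient_eq_zero_of_mem_segment {a b x y z : ℝ × ℝ} (hx : x ∈ segment ℝ a b)
    (hy : y ∈ segment ℝ a b) (hz : z ∈ segment ℝ a b) : orient x y z = 0 := by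
  rw [segment_eq_image'] at hx hy hz
  obtain ⟨r, -, rfl⟩ := hx
  obtain ⟨s, -, rfl⟩ := hy
  obtain ⟨t, -, rfl⟩ := hz
  simp only [orient, cross, Prod.fst_sub, Prod.snd_sub, Prod.fst_add, Prod.snd_add,
    Prod.smul_fst, Prod.smul_snd, smul_eq_mul]
  ring

/-- The vertices of the hexagon `|x| ≤ 1`, `|y| ≤ 1`, `|x + y| ≤ 1`. -/
noncomputable def hexagonVertices : Finset (ℝ × ℝ) :=
  (Finset.range 6).image fun k => sixthTurn^[k] (1, -1)

theorem sixthTurn_iterate_mem_hexagonVertices (k : ℕ) :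
    sixthTurn^[k] (1, -1) ∈ hexagonVertices := by
  have : Function.IsPeriodicPt sixthTurn 6 (1, -1) := sixthTurn_iterate_six _
  rw [← this.iterate_mod_apply]
  exact Finset.mem_image_of_mem _ (Finset.mem_range.2 (Nat.mod_lt _ (by norm_num)))

theorem mem_hexagonVertices {v : ℝ × ℝ} (hv : v ∈ hexagonVertices) :
    v = (1, -1) ∨ v = (1, 0) ∨ v = (0, 1) ∨ v = (-1, 1) ∨ v = (-1, 0) ∨ v = (0, -1) := by
  obtain ⟨k, hk, rfl⟩ := Finset.mem_image.1 hv
  have := Finset.mem_range.1 hk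
  interval_cases k <;> simp [sixthTurn]

theorem one_zero_mem_hexagonVertices : ((1, 0) : ℝ × ℝ) ∈ hexagonVertices := by
  simpa [sixthTurn] using sixthTurn_iterate_mem_hexagonVertices 1

theorem zero_one_mem_hexagonVertices : ((0, 1) : ℝ × ℝ) ∈ hexagonVertices := by
  simpa [sixthTurn] using sixthTurn_iterate_mem_hexagonVertices 2

theorem neg_one_zero_mem_hexagonVertices : ((-1, 0) : ℝ × ℝ) ∈ hexagonVertices := by
  simpa [sixthTurn] using sixthTurn_iterate_mem_hexagonVertices 4

theorem seven_halves_le_volume_real {W : Finset (ℝ × ℝ)} (hW : W.card ≤ 5)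
    (h : convexHull ℝ (hexagonVertices : Set (ℝ × ℝ)) ⊆ convexHull ℝ (W : Set (ℝ × ℝ))) :
    7 / 2 ≤ volume.real (convexHull ℝ (W : Set (ℝ × ℝ))) := by
  obtain ⟨T, hTW, hT, hconv⟩ := exists_convexPosition_subset W
  rw [← hT] at h ⊢
  have hTc := (Finset.card_le_card hTW).trans hW
  have hmem : ∀ v ∈ hexagonVertices, v ∈ convexHull ℝ (T : Set (ℝ × ℝ)) := fun v hv =>
    h (subset_convexHull ℝ _ hv)
  obtain ⟨m, hm⟩ : ∃ m, T.card = m + 1 := by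
    refine Nat.exists_eq_succ_of_ne_zero fun h0 => ?_
    have := hmem _ one_zero_mem_hexagonVertices
    rw [Finset.card_eq_zero.1 h0] at this
    simp at this
  obtain ⟨q, hq, hr⟩ := exists_convexChain hconv hm
  rw [← hr] at hmem ⊢
  have hm2 : 3 ≤ m + 1 := by
    by_contra! hlt
    have hsub : Set.range q ⊆ {q 0, q (Fin.last m)} := by
      rintro _ ⟨i, rfl⟩
      rcases eq_or_ne i 0 with rfl | hi
      · simp
      · have : i = Fin.last m := by
          have := Fin.pos_iff_ne_zero.2 hi
          rw [Fin.lt_def, Fin.val_zero] at this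
          rw [Fin.ext_iff, Fin.val_last]
          omega
        simp [this]
    have hseg : ∀ v ∈ hexagonVertices, v ∈ segment ℝ (q 0) (q (Fin.last m)) := fun v hv => by
      rw [← convexHull_pair]
      exact convexHull_mono hsub (hmem v hv)
    have := orient_eq_zero_of_mem_segment (hseg _ one_zero_mem_hexagonVertices)
      (hseg _ zero_one_mem_hexagonVertices) (hseg _ neg_one_zero_mem_hexagonVertices)
    norm_num [orient, cross] at this
  have hA := hq.strictlyConvexCycle
  have h1 := hA.twelve_sub_le_shoelace hm2 fun i k =>
    hA.orient_nonneg i (hmem _ (sixthTurn_iterate_mem_hexagonVertices k))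
  have h2 := hq.shoelace_le
  have h3 : ((m + 1 : ℕ) : ℝ) ≤ 5 := by
    rw [← hm]
    exact_mod_cast hTc
  linarith

theorem volume_real_hexagon_le :
    volume.real (convexHull ℝ (hexagonVertices : Set (ℝ × ℝ))) ≤ 3 := by
  set H := convexHull ℝ (hexagonVertices : Set (ℝ × ℝ))
  have hH : ∀ p q : ℝ × ℝ, (∀ v ∈ hexagonVertices, 0 ≤ orient p q v) → ∀ x ∈ H,
      0 ≤ orient p q x := fun p q hpq x hx => orient_nonneg_of_mem_convexHull hpq hx
  have o1 : orient (1, 1) (0, 1) (1, 0) = 1 := by norm_num [orient, cross]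
  have o2 : orient (-1, -1) (0, -1) (-1, 0) = 1 := by norm_num [orient, cross]
  set T₁ := {x | 0 < orient (1, 0) (1, 1) x ∧ 0 < orient (1, 1) (0, 1) x ∧
    0 < orient (0, 1) (1, 0) x}
  set T₂ := {x | 0 < orient (-1, 0) (-1, -1) x ∧ 0 < orient (-1, -1) (0, -1) x ∧
    0 < orient (0, -1) (-1, 0) x}
  have v1 : volume.real T₁ = 1 / 2 := by rw [volume_real_open_triangle (by rw [o1]; simp), o1]
  have v2 : volume.real T₂ = 1 / 2 := by rw [volume_real_open_triangle (by rw [o2]; simp), o2]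
  have m1 : MeasurableSet T₁ := (isOpen_open_triangle _ _ _).measurableSet
  have m2 : MeasurableSet T₂ := (isOpen_open_triangle _ _ _).measurableSet
  have box : H ∪ T₁ ∪ T₂ ⊆ Set.Icc (-1 : ℝ) 1 ×ˢ Set.Icc (-1 : ℝ) 1 := by
    refine Set.union_subset (Set.union_subset (convexHull_min (fun v hv => ?_)
      ((convex_Icc _ _).prod (convex_Icc _ _))) fun x hx => ?_) fun x hx => ?_
    · rcases mem_hexagonVertices hv with rfl | rfl | rfl | rfl | rfl | rfl <;> norm_num
    · simp only [T₁, orient, cross, Prod.fst_sub, Prod.snd_sub, Set.mem_ofPred_eq] at hx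
      simp only [Set.mem_prod, Set.mem_Icc]
      refine ⟨⟨?_, ?_⟩, ?_, ?_⟩ <;> linarith
    · simp only [T₂, orient, cross, Prod.fst_sub, Prod.snd_sub, Set.mem_ofPred_eq] at hx
      simp only [Set.mem_prod, Set.mem_Icc]
      refine ⟨⟨?_, ?_⟩, ?_, ?_⟩ <;> linarith
  have hfin : volume (Set.Icc (-1 : ℝ) 1 ×ˢ Set.Icc (-1 : ℝ) 1) ≠ ⊤ := by
    rw [Measure.volume_eq_prod, Measure.prod_prod]
    simp [ENNReal.mul_eq_top]
  have hbox : volume.real (Set.Icc (-1 : ℝ) 1 ×ˢ Set.Icc (-1 : ℝ) 1) = 4 := by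
    rw [measureReal_def, Measure.volume_eq_prod, Measure.prod_prod]
    norm_num
  have d1 : Disjoint H T₁ := by
    rw [Set.disjoint_left]
    intro x hx hxT
    have := hH (1, 0) (0, 1) (fun v hv => by
      rcases mem_hexagonVertices hv with rfl | rfl | rfl | rfl | rfl | rfl <;>
        norm_num [orient, cross]) x hx
    rw [orient_swap] at this
    linarith [hxT.2.2]
  have d2 : Disjoint (H ∪ T₁) T₂ := by
    rw [Set.disjoint_left]
    rintro x (hx | hx) hxT
    · have := hH (-1, 0) (0, -1) (fun v hv => by
        rcases mem_hexagonVertices hv with rfl | rfl | rfl | rfl | rfl | rfl <;>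
          norm_num [orient, cross]) x hx
      rw [orient_swap] at this
      linarith [hxT.2.2]
    · simp only [T₁, T₂, orient, cross, Prod.fst_sub, Prod.snd_sub, Set.mem_ofPred_eq] at hx hxT
      linarith
  have fin : ∀ s ⊆ H ∪ T₁ ∪ T₂, volume s ≠ ⊤ := fun s hs =>
    ne_top_of_le_ne_top hfin (measure_mono (hs.trans box))
  have hle := measureReal_mono box hfin
  rw [measureReal_union d2 m2 (fin _ Set.subset_union_left) (fin _ Set.subset_union_right),
    measureReal_union d1 m1
      (fin _ (Set.subset_union_left.trans Set.subset_union_left))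
      (fin _ (Set.subset_union_right.trans Set.subset_union_left)), v1, v2, hbox] at hle
  linarith

theorem isConvexPolygon_hexagon :
    IsConvexPolygon 6 (convexHull ℝ (hexagonVertices : Set (ℝ × ℝ))) := by
  refine ⟨hexagonVertices, Finset.card_image_le.trans (by simp), rfl, (0, 1 / 2), ?_⟩
  have h : 0 < orient (1, 0) (0, 1) (-1, 0) := by norm_num [orient, cross]
  refine interior_maximal (fun x hx => mem_convexHull_of_orient_nonneg one_zero_mem_hexagonVertices
    zero_one_mem_hexagonVertices neg_one_zero_mem_hexagonVertices h
    ⟨hx.1.le, hx.2.1.le, hx.2.2.le⟩) (isOpen_open_triangle _ _ _) ?_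
  norm_num [orient, cross]

theorem IsConvexPolygon.volume_real_pos {n : ℕ} {P : Set (ℝ × ℝ)} (h : IsConvexPolygon n P) :
    0 < volume.real P := by
  obtain ⟨S, -, rfl, hint⟩ := h
  rw [measureReal_def]
  exact ENNReal.toReal_pos (Measure.measure_pos_of_nonempty_interior _ hint).ne'
    (volume_convexHull_ne_top S.finite_toSet)

theorem IsConvexPolygon.exists_pentagon {P : Set (ℝ × ℝ)} (h : IsConvexPolygon 6 P) :
    ∃ Q, IsConvexPolygon 5 Q ∧ P ⊆ Q ∧ (volume Q).toReal / (volume P).toReal ≤ 7 / 6 := by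
  have hpos := h.volume_real_pos
  obtain ⟨S, hS, rfl, hint⟩ := h
  obtain ⟨W, hW, hsub, hvol⟩ := exists_pentagon_volume_le hS
  exact ⟨_, ⟨W, hW, rfl, hint.mono (interior_mono hsub)⟩, hsub, (div_le_iff₀ hpos).2 hvol⟩

/-- `r(5,6) = 7/6`: the supremum over convex hexagons `P` of the infimum over
convex pentagons `Q ⊇ P` of the ratio `|Q|/|P|` equals `7/6`. -/
theorem r_five_six :
    sSup {r : ℝ | ∃ P : Set (ℝ × ℝ), IsConvexPolygon 6 P ∧
      r = sInf {s : ℝ | ∃ Q : Set (ℝ × ℝ), IsConvexPolygon 5 Q ∧ P ⊆ Q ∧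
        s = (volume Q).toReal / (volume P).toReal}} = 7 / 6 := by
  have upper : ∀ P : Set (ℝ × ℝ), IsConvexPolygon 6 P →
      sInf {s : ℝ | ∃ Q : Set (ℝ × ℝ), IsConvexPolygon 5 Q ∧ P ⊆ Q ∧
        s = (volume Q).toReal / (volume P).toReal} ≤ 7 / 6 := by
    intro P hP
    obtain ⟨Q, hQ, hPQ, hle⟩ := hP.exists_pentagon
    refine le_trans (csInf_le ?_ ⟨Q, hQ, hPQ, rfl⟩) hle
    refine ⟨0, ?_⟩
    rintro _ ⟨Q, -, -, rfl⟩
    positivity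
  refine le_antisymm (csSup_le ?_ ?_) ?_
  · exact ⟨_, _, isConvexPolygon_hexagon, rfl⟩
  · rintro _ ⟨P, hP, rfl⟩
    exact upper P hP
  · refine le_csSup_of_le ⟨7 / 6, ?_⟩ ⟨_, isConvexPolygon_hexagon, rfl⟩ ?_
    · rintro _ ⟨P, hP, rfl⟩
      exact upper P hP
    · obtain ⟨Q, hQ, hsub, -⟩ := isConvexPolygon_hexagon.exists_pentagon
      refine le_csInf ⟨_, Q, hQ, hsub, rfl⟩ ?_
      rintro _ ⟨Q, ⟨W, hW, rfl, -⟩, hsub, rfl⟩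
      have h1 := seven_halves_le_volume_real hW hsub
      have h2 := volume_real_hexagon_le
      refine (le_div_iff₀ isConvexPolygon_hexagon.volume_real_pos).2 (le_trans ?_ h1)
      linarith
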